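/- For every δ > 0 there exists N(δ) such that the following holds for every n ≥ N(δ). Let t be an integer with δn ≤ t ≤ (2n−6)/9 + 1, set N = ex(n,(t+1)K3) + 2, and let χ : E(K_n) → {1,…,N} be a surjective edge-coloring admitting no rainbow copy of (t+2)K3. Let H ⊆ K_n be a representative graph of χ, let (T, M, I) be a maximal tiling triple of H and (T1, T2, T3, T4) an ideal partition of T satisfying: t1 := |T1| ∈ [t−1, t+1], m := |M| ∈ ((n−3(t+1))/2 − √(2n)/2, (n−3(t+1))/2], and |I| < √(2n). Then the subgraph of H induced by V(T1) ∪ V(M) contains a complete 3-partite subgraph with parts of sizes t1−10, m+t1−10, and m+t1−10. -/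

import Mathlib

open Finset

/-- `H` contains `k` pairwise vertex-disjoint triangles. -/
def HasKDisjointTriangles {n : ℕ} (H : SimpleGraph (Fin n)) (k : ℕ) : Prop :=
  ∃ T : Finset (Finset (Fin n)), T.card = k ∧ (∀ s ∈ T, H.IsNClique 3 s) ∧
    (T : Set (Finset (Fin n))).Pairwise fun s₁ s₂ => Disjoint s₁ s₂

/-- Under the edge-coloring `χ`, the graph `H` contains a rainbow copy of `k`
pairwise vertex-disjoint triangles. -/
def HasRainbowKTriangles {n : ℕ} (H : SimpleGraph (Fin n)) (χ : Sym2 (Fin n) → ℕ)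
    (k : ℕ) : Prop :=
  ∃ T : Finset (Finset (Fin n)), T.card = k ∧ (∀ s ∈ T, H.IsNClique 3 s) ∧
    ((T : Set (Finset (Fin n))).Pairwise fun s₁ s₂ => Disjoint s₁ s₂) ∧
    Set.InjOn χ {e : Sym2 (Fin n) | ¬ e.IsDiag ∧ ∃ s ∈ T, ∀ x ∈ e, x ∈ s}

/-- `χ` is a surjective edge-coloring of `K_n` with colors `{1, …, N}`. -/
def IsSurjColoring (n N : ℕ) (χ : Sym2 (Fin n) → ℕ) : Prop :=
  (∀ e : Sym2 (Fin n), ¬ e.IsDiag → χ e ∈ Finset.Icc 1 N) ∧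
  (∀ c ∈ Finset.Icc 1 N, ∃ e : Sym2 (Fin n), ¬ e.IsDiag ∧ χ e = c)

/-- `ex(n, kK₃)`: the maximum number of edges of an `n`-vertex graph containing no `k`
pairwise vertex-disjoint triangles. -/
noncomputable def exTriangles (n k : ℕ) : ℕ :=
  sSup {m : ℕ | ∃ H : SimpleGraph (Fin n), ¬ HasKDisjointTriangles H k ∧
    H.edgeSet.ncard = m}

/-- `H` is a representative graph of the `N`-coloring `χ`: it is rainbow and has
exactly `N` edges. -/
def IsRepGraph {n : ℕ} (χ : Sym2 (Fin n) → ℕ) (N : ℕ) (H : SimpleGraph (Fin n)) : Prop :=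
  H.edgeSet.ncard = N ∧ Set.InjOn χ H.edgeSet

/-- The edge `e` (a set of two vertices) sees the vertex `w` of the triangle `s`:
`w ∈ s` and both endpoints of `e` are adjacent to `w` in `H`. -/
def seesAt {n : ℕ} (H : SimpleGraph (Fin n)) (e s : Finset (Fin n)) (w : Fin n) : Prop :=
  w ∈ s ∧ ∀ u ∈ e, H.Adj u w

/-- The edge `e` sees the triangle `s`. -/
def sees {n : ℕ} (H : SimpleGraph (Fin n)) (e s : Finset (Fin n)) : Prop :=
  ∃ w, seesAt H e s w

/-- The vertex `p` sees the triangle `s`: `p` is adjacent to two distinct vertices of `s`. -/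
def vertexSees {n : ℕ} (H : SimpleGraph (Fin n)) (p : Fin n) (s : Finset (Fin n)) : Prop :=
  ∃ w₁ ∈ s, ∃ w₂ ∈ s, w₁ ≠ w₂ ∧ H.Adj p w₁ ∧ H.Adj p w₂

/-- The triangle `u` sees the triangle `s`: some edge of `u` sees `s`. -/
def triSees {n : ℕ} (H : SimpleGraph (Fin n)) (u s : Finset (Fin n)) : Prop :=
  ∃ a ∈ u, ∃ b ∈ u, a ≠ b ∧ sees H {a, b} s

/-- `(T, M, I)` is a tiling triple of `H`: `T` is a family of pairwise vertex-disjoint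
triangles, `M` is a matching, `I` is an independent set, and `V(T), V(M), I` partition
the vertex set. -/
def IsTilingTriple {n : ℕ} (H : SimpleGraph (Fin n)) (T M : Finset (Finset (Fin n)))
    (I : Finset (Fin n)) : Prop :=
  (∀ s ∈ T, H.IsNClique 3 s) ∧ (∀ e ∈ M, H.IsNClique 2 e) ∧
  (∀ x ∈ I, ∀ y ∈ I, ¬ H.Adj x y) ∧
  (((T ∪ M : Finset (Finset (Fin n))) : Set (Finset (Fin n))).Pairwise
    fun s₁ s₂ => Disjoint s₁ s₂) ∧
  Disjoint ((T ∪ M).biUnion id) I ∧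
  (T ∪ M).biUnion id ∪ I = Finset.univ

/-- `(T, M, I)` is a tiling triple of `H` with `(|T|, |M|)` lexicographically maximal. -/
def IsMaxTilingTriple {n : ℕ} (H : SimpleGraph (Fin n)) (T M : Finset (Finset (Fin n)))
    (I : Finset (Fin n)) : Prop :=
  IsTilingTriple H T M I ∧
  ∀ T' M' : Finset (Finset (Fin n)), ∀ I' : Finset (Fin n), IsTilingTriple H T' M' I' →
    T'.card < T.card ∨ (T'.card = T.card ∧ M'.card ≤ M.card)

/-- The number of edges of `H` between the (disjoint) vertex sets `A` and `B`. -/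
noncomputable def eBetween {n : ℕ} (H : SimpleGraph (Fin n)) (A B : Set (Fin n)) : ℕ :=
  Set.ncard {p : Fin n × Fin n | p.1 ∈ A ∧ p.2 ∈ B ∧ H.Adj p.1 p.2}

/-- `(T₁, T₂, T₃, T₄)` is an ideal partition of `T` for the tiling triple `(T, M, I)`:
`T₁` consists of the triangles of `T` seen by at least two edges of `M`; `T₂` consists of
the triangles of `T ∖ T₁` seen by at least two other members of `T`, or by one edge of
`M` and at least one vertex of `I`; and `(T₃, T₄)` arises from the greedy removal process
on `D = T ∖ (T₁ ∪ T₂)`: while some triangle of `D` sends at most `8(|D|−1)` edges to the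
other triangles of `D`, it is removed (the removed triangles, in order, form `T₃`),
and `T₄` is the final set `D`, in which every triangle sends more than `8(|T₄|−1)`
edges to the other triangles of `T₄`. -/
def IsIdealPartition {n : ℕ} (H : SimpleGraph (Fin n)) (T M : Finset (Finset (Fin n)))
    (I : Finset (Fin n)) (T₁ T₂ T₃ T₄ : Finset (Finset (Fin n))) : Prop :=
  T₁ ∪ T₂ ∪ T₃ ∪ T₄ = T ∧
  Disjoint T₁ T₂ ∧ Disjoint T₁ T₃ ∧ Disjoint T₁ T₄ ∧
  Disjoint T₂ T₃ ∧ Disjoint T₂ T₄ ∧ Disjoint T₃ T₄ ∧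
  (∀ s, s ∈ T₁ ↔ s ∈ T ∧ ∃ e₁ ∈ M, ∃ e₂ ∈ M, e₁ ≠ e₂ ∧ sees H e₁ s ∧ sees H e₂ s) ∧
  (∀ s, s ∈ T₂ ↔ s ∈ T ∧ s ∉ T₁ ∧
    ((∃ s₁ ∈ T, ∃ s₂ ∈ T, s₁ ≠ s₂ ∧ s₁ ≠ s ∧ s₂ ≠ s ∧ triSees H s₁ s ∧ triSees H s₂ s) ∨
      ((∃ e ∈ M, sees H e s) ∧ (∃ p ∈ I, vertexSees H p s)))) ∧
  (∃ k : ℕ, ∃ g : Fin k → Finset (Fin n), Function.Injective g ∧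
    Finset.image g Finset.univ = T₃ ∧
    ∀ j : Fin k,
      eBetween H (↑(g j))
          (↑((((Finset.univ.filter fun i : Fin k => j < i).image g) ∪ T₄).biUnion id))
        ≤ 8 * (k - (j : ℕ) + T₄.card - 1)) ∧
  (∀ s ∈ T₄, 8 * (T₄.card - 1) < eBetween H (↑s) (↑((T₄.erase s).biUnion id)))

/-- `x` is the critical vertex of the triangle `s` (with respect to the matching `M`):
some edge of `M` sees `x` of `s`, and every edge of `M` seeing `s` sees only `x` of `s`. -/
def IsCriticalVertex {n : ℕ} (H : SimpleGraph (Fin n)) (M : Finset (Finset (Fin n)))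
    (s : Finset (Fin n)) (x : Fin n) : Prop :=
  x ∈ s ∧ (∃ e ∈ M, seesAt H e s x) ∧ ∀ e ∈ M, ∀ w, seesAt H e s w → w = x

/-- The set of non-critical vertices of the triangles in `T₁`. -/
def nonCriticalVerts {n : ℕ} (H : SimpleGraph (Fin n)) (M T₁ : Finset (Finset (Fin n))) :
    Set (Fin n) :=
  {w | ∃ s ∈ T₁, ∃ x, IsCriticalVertex H M s x ∧ w ∈ s ∧ w ≠ x}

section Counting

variable {V : Type*}

open Classical in
/-- The number of neighbours of `v` in the set `X`. -/
noncomputable def degIn (H : SimpleGraph V) (X : Finset V) (v : V) : ℕ :=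
  #{w ∈ X | H.Adj v w}

/-- The number of ordered adjacent pairs in `X × Y`. -/
noncomputable def adjPairs (H : SimpleGraph V) (X Y : Finset V) : ℕ :=
  ∑ v ∈ X, degIn H Y v

theorem degIn_le_card (H : SimpleGraph V) (X : Finset V) (v : V) : degIn H X v ≤ #X := by
  classical exact card_filter_le _ _

theorem degIn_mono (H : SimpleGraph V) {X Y : Finset V} (h : X ⊆ Y) (v : V) :
    degIn H X v ≤ degIn H Y v := by
  classical exact card_le_card (filter_subset_filter _ h)

theorem degIn_add_one_le_card (H : SimpleGraph V) {X : Finset V} {v : V} (hv : v ∈ X) :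
    degIn H X v + 1 ≤ #X := by
  classical
  refine card_lt_card (filter_ssubset.2 ⟨v, hv, H.loopless.irrefl v⟩)

theorem adjPairs_comm (H : SimpleGraph V) (X Y : Finset V) :
    adjPairs H X Y = adjPairs H Y X := by
  classical
  unfold adjPairs degIn
  simp only [card_filter]
  rw [sum_comm]
  simp only [H.adj_comm]

theorem adjPairs_le_card_mul (H : SimpleGraph V) (X Y : Finset V) {d : ℕ}
    (h : ∀ v ∈ X, degIn H Y v ≤ d) : adjPairs H X Y ≤ #X * d := by
  exact sum_le_card_nsmul X _ d h

theorem adjPairs_le_mul (H : SimpleGraph V) (X Y : Finset V) :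
    adjPairs H X Y ≤ #X * #Y :=
  adjPairs_le_card_mul H X Y fun v _ => degIn_le_card H Y v

theorem two_mul_ncard_edgeSet [Fintype V] (H : SimpleGraph V) :
    2 * H.edgeSet.ncard = adjPairs H univ univ := by
  classical
  have := H.sum_degrees_eq_twice_card_edges
  rw [Set.ncard_eq_toFinset_card', Set.toFinset_card, ← SimpleGraph.edgeFinset_card, ← this]
  refine sum_congr rfl fun v _ => ?_
  rw [← SimpleGraph.card_neighborFinset_eq_degree, SimpleGraph.neighborFinset_eq_filter]
  unfold degIn
  congr

/-- Few vertices of `X` miss more than `q` vertices of `Y`. -/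
theorem card_filter_mul_le (H : SimpleGraph V) (X Y : Finset V) (q : ℕ) :
    #{v ∈ X | degIn H Y v + q < #Y} * q + adjPairs H X Y ≤ #X * #Y := by
  have h : adjPairs H X Y ≤ ∑ v ∈ X, (#Y - if degIn H Y v + q < #Y then q else 0) := by
    refine sum_le_sum fun v _ => ?_
    have := degIn_le_card H Y v
    split_ifs <;> omega
  have h2 : ∑ v ∈ X, (#Y - if degIn H Y v + q < #Y then q else 0) +
      ∑ v ∈ X, (if degIn H Y v + q < #Y then q else 0) = #X * #Y := by
    rw [← sum_add_distrib, ← smul_eq_mul, ← sum_const]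
    refine sum_congr rfl fun v _ => ?_
    split_ifs <;> omega
  rw [← sum_filter, sum_const, smul_eq_mul] at h2
  omega

variable [DecidableEq V]

theorem degIn_union_le (H : SimpleGraph V) (X Y : Finset V) (v : V) :
    degIn H (X ∪ Y) v ≤ degIn H X v + degIn H Y v := by
  classical
  unfold degIn
  rw [filter_union]
  exact card_union_le _ _

theorem degIn_biUnion_le (H : SimpleGraph V) {ι : Type*} (s : Finset ι) (f : ι → Finset V)
    (v : V) : degIn H (s.biUnion f) v ≤ ∑ i ∈ s, degIn H (f i) v := by
  classical
  unfold degIn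
  rw [filter_biUnion]
  exact card_biUnion_le

theorem card_inter_lt_of_degIn (H : SimpleGraph V) (X F : Finset V) (v : V)
    (h : #(F ∩ X) < degIn H X v) : ∃ w ∈ X, w ∉ F ∧ H.Adj v w := by
  classical
  obtain ⟨w, hw, hwF⟩ := exists_mem_notMem_of_card_lt_card h
  rw [mem_filter] at hw
  exact ⟨w, hw.1, fun h' => hwF (mem_inter.2 ⟨h', hw.1⟩), hw.2⟩

theorem exists_common_adj_of_degIn (H : SimpleGraph V) (X F : Finset V) (u v : V)
    (h : #X + #(F ∩ X) < degIn H X u + degIn H X v) :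
    ∃ w ∈ X, w ∉ F ∧ H.Adj u w ∧ H.Adj v w := by
  classical
  unfold degIn at h
  rw [← card_union_add_card_inter (X.filter (H.Adj u)) (X.filter (H.Adj v))] at h
  have h1 : #((X.filter (H.Adj u)) ∪ X.filter (H.Adj v)) ≤ #X :=
    card_le_card (union_subset (filter_subset _ _) (filter_subset _ _))
  obtain ⟨w, hw, hwF⟩ := exists_mem_notMem_of_card_lt_card
    (show #(F ∩ X) < #((X.filter (H.Adj u)) ∩ X.filter (H.Adj v)) by omega)
  rw [mem_inter, mem_filter, mem_filter] at hw
  exact ⟨w, hw.1.1, fun h' => hwF (mem_inter.2 ⟨h', hw.1.1⟩), hw.1.2, hw.2.2⟩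

theorem adjPairs_union_left (H : SimpleGraph V) {X Y : Finset V} (h : Disjoint X Y)
    (Z : Finset V) : adjPairs H (X ∪ Y) Z = adjPairs H X Z + adjPairs H Y Z :=
  sum_union h

theorem adjPairs_union_right (H : SimpleGraph V) {X Y : Finset V} (h : Disjoint X Y)
    (Z : Finset V) : adjPairs H Z (X ∪ Y) = adjPairs H Z X + adjPairs H Z Y := by
  rw [adjPairs_comm, adjPairs_union_left H h, adjPairs_comm H X, adjPairs_comm H Y]

theorem adjPairs_union_self (H : SimpleGraph V) {X Y : Finset V} (h : Disjoint X Y) :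
    adjPairs H (X ∪ Y) (X ∪ Y) =
      adjPairs H X X + 2 * adjPairs H X Y + adjPairs H Y Y := by
  rw [adjPairs_union_left H h, adjPairs_union_right H h, adjPairs_union_right H h,
    adjPairs_comm H Y X]
  ring

end Counting

section Greedy

variable {V : Type*} [DecidableEq V]

/-- Greedy completion: if every core `D ∈ X` can be completed outside any set meeting `B` and `C`
in at most `β` vertices, then all cores can be completed disjointly outside `F`. -/
theorem exists_disjoint_completions (G : SimpleGraph V) (B C : Finset V) (β : ℕ)
    (X : Finset (Finset V))
    (hext : ∀ D ∈ X, ∀ F : Finset V, #(F ∩ B) ≤ β → #(F ∩ C) ≤ β → ∃ P, Disjoint P F ∧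
      #(P ∩ B) ≤ 1 ∧ #(P ∩ C) ≤ 1 ∧ G.IsNClique 3 (D ∪ P))
    (F : Finset V) (hFB : #(F ∩ B) + #X ≤ β) (hFC : #(F ∩ C) + #X ≤ β) :
    ∃ φ : Finset V → Finset V, (∀ D ∈ X, Disjoint (φ D) F ∧ #(φ D ∩ B) ≤ 1 ∧
      #(φ D ∩ C) ≤ 1 ∧ G.IsNClique 3 (D ∪ φ D)) ∧
      (X : Set (Finset V)).Pairwise fun D D' => Disjoint (φ D) (φ D') := by
  induction X using Finset.induction_on generalizing F with
  | empty => exact ⟨fun _ => ∅, by simp, by simp⟩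
  | insert D X hD ih =>
    rw [card_insert_of_notMem hD] at hFB hFC
    obtain ⟨P, hPF, hPB, hPC, hP⟩ :=
      hext D (mem_insert_self _ _) F (by omega) (by omega)
    have key : ∀ Y : Finset V, #(P ∩ Y) ≤ 1 → #((F ∪ P) ∩ Y) ≤ #(F ∩ Y) + 1 := by
      intro Y hY
      rw [union_inter_distrib_right]
      exact (card_union_le _ _).trans (by omega)
    obtain ⟨φ, h1, h2⟩ := ih (fun D' hD' => hext D' (mem_insert_of_mem hD')) (F ∪ P)
      (by have := key B hPB; omega) (by have := key C hPC; omega)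
    have hne : ∀ D' ∈ X, D' ≠ D := fun D' hD' h => hD (h ▸ hD')
    refine ⟨Function.update φ D P, ?_, ?_⟩
    · intro D' hD'
      rcases mem_insert.1 hD' with rfl | hD'
      · simpa using ⟨hPF, hPB, hPC, hP⟩
      · rw [Function.update_of_ne (hne D' hD')]
        obtain ⟨h3, h4⟩ := h1 D' hD'
        exact ⟨(disjoint_union_right.1 h3).1, h4⟩
    · have : Std.Symm fun D' D'' => Disjoint (Function.update φ D P D') (Function.update φ D P D'') :=
        ⟨fun _ _ h => h.symm⟩
      rw [coe_insert, Set.pairwise_insert_of_symm_of_notMem hD]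
      refine ⟨?_, ?_⟩
      · intro D₁ hD₁ D₂ hD₂ h
        rw [Function.update_of_ne (hne D₁ hD₁), Function.update_of_ne (hne D₂ hD₂)]
        exact h2 hD₁ hD₂ h
      · intro D' hD'
        rw [Function.update_self, Function.update_of_ne (hne D' hD')]
        exact (disjoint_union_right.1 (h1 D' hD').1).2.symm

theorem isNClique_three_of_core_singleton (G : SimpleGraph V) {a b c : V} (hab : G.Adj a b)
    (hac : G.Adj a c) (hbc : G.Adj b c) : G.IsNClique 3 ({a} ∪ {b, c}) := by
  rw [SimpleGraph.is3Clique_iff]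
  exact ⟨a, b, c, hab, hac, hbc, rfl⟩

theorem exists_completion_of_vertex (G : SimpleGraph V) {B C F : Finset V} (hBC : Disjoint B C)
    {a : V} {p : ℕ} (hB : ∀ b ∈ B, #C ≤ degIn G C b + p)
    (haB : #(F ∩ B) < degIn G B a) (haC : #(F ∩ C) + p < degIn G C a) :
    ∃ P, Disjoint P F ∧ #(P ∩ B) ≤ 1 ∧ #(P ∩ C) ≤ 1 ∧ G.IsNClique 3 ({a} ∪ P) := by
  obtain ⟨b, hb, hbF, hab⟩ := card_inter_lt_of_degIn G B F a haB
  obtain ⟨c, hc, hcF, hac, hbc⟩ := exists_common_adj_of_degIn G C F a b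
    (by have := hB b hb; omega)
  refine ⟨{b, c}, by simp [hbF, hcF], ?_, ?_, isNClique_three_of_core_singleton G hab hac hbc⟩
  · rw [card_le_one]
    have := disjoint_right.1 hBC hc
    aesop
  · rw [card_le_one]
    have := disjoint_left.1 hBC hb
    aesop

theorem exists_completion_of_edge (G : SimpleGraph V) {B C X F : Finset V}
    {u v : V} (huv : G.Adj u v) (h : #X + #(F ∩ X) < degIn G X u + degIn G X v) :
    ∃ P, Disjoint P F ∧ #(P ∩ B) ≤ 1 ∧ #(P ∩ C) ≤ 1 ∧ G.IsNClique 3 ({u, v} ∪ P) := by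
  obtain ⟨w, -, hwF, huw, hvw⟩ := exists_common_adj_of_degIn G X F u v h
  refine ⟨{w}, by simpa using hwF, (card_le_card inter_subset_left).trans (by simp),
    (card_le_card inter_subset_left).trans (by simp), ?_⟩
  rw [SimpleGraph.is3Clique_iff]
  exact ⟨u, v, w, huv, huw, hvw, by ext; simp⟩

end Greedy

theorem hasKDisjointTriangles_of_completions {n : ℕ} (G : SimpleGraph (Fin n))
    (X : Finset (Finset (Fin n))) (F : Finset (Fin n)) (φ : Finset (Fin n) → Finset (Fin n))
    (hXF : ∀ D ∈ X, D ⊆ F)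
    (hX : (X : Set (Finset (Fin n))).Pairwise fun D D' => Disjoint D D')
    (hφ : ∀ D ∈ X, Disjoint (φ D) F ∧ G.IsNClique 3 (D ∪ φ D))
    (hφX : (X : Set (Finset (Fin n))).Pairwise fun D D' => Disjoint (φ D) (φ D')) :
    HasKDisjointTriangles G #X := by
  have hdis : ∀ D ∈ X, ∀ D' ∈ X, D ≠ D' → Disjoint (D ∪ φ D) (D' ∪ φ D') := by
    intro D hD D' hD' hne
    simp only [disjoint_union_left, disjoint_union_right]
    exact ⟨⟨hX hD hD' hne, (hφ D hD).1.mono_right (hXF D' hD')⟩,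
      ((hφ D' hD').1.mono_right (hXF D hD)).symm, hφX hD hD' hne⟩
  refine ⟨X.image fun D => D ∪ φ D, card_image_of_injOn ?_, ?_, ?_⟩
  · intro D hD D' hD' h
    by_contra hne
    have h1 := hdis D hD D' hD' hne
    simp only at h
    rw [← h, disjoint_self_iff_empty] at h1
    have := (hφ D hD).2.card_eq
    simp [h1] at this
  · simp only [mem_image]
    rintro _ ⟨D, hD, rfl⟩
    exact (hφ D hD).2
  · rw [coe_image]
    rintro _ ⟨D, hD, rfl⟩ _ ⟨D', hD', rfl⟩ hne
    exact hdis D hD D' hD' fun h => hne (by rw [h])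

/-- In a graph that is almost complete between `A`, `B` and `C`, the vertices of `A`, a few further
vertices `X`, and a few disjoint edges `E` extend to disjoint triangles. -/
theorem hasKDisjointTriangles_of_robust {n : ℕ} (G : SimpleGraph (Fin n))
    (A X B C : Finset (Fin n)) (E : Finset (Finset (Fin n))) (q : ℕ) (hq : 0 < q)
    (hBC : Disjoint B C) (hAB : Disjoint A B) (hAC : Disjoint A C) (hAX : Disjoint A X)
    (hE : ∀ e ∈ E, ∃ u v, e = {u, v} ∧ G.Adj u v ∧ Disjoint e (A ∪ X) ∧
      (#B + 20 * q ≤ degIn G B u + degIn G B v ∨ #C + 20 * q ≤ degIn G C u + degIn G C v))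
    (hEd : (E : Set (Finset (Fin n))).Pairwise fun e e' => Disjoint e e')
    (hEq : #E ≤ 3 * q) (hXq : #X ≤ 3 * q)
    (hX : ∀ x ∈ X, 20 * q ≤ degIn G B x ∧ 20 * q ≤ degIn G C x)
    (hA : ∀ a ∈ A, #B ≤ degIn G B a + q ∧ #C ≤ degIn G C a + q)
    (hB : ∀ b ∈ B, #C ≤ degIn G C b + q)
    (hBbig : #A + 18 * q < #B) (hCbig : #A + 18 * q < #C) :
    HasKDisjointTriangles G (#A + #X + #E) := by
  set F₀ := A ∪ X ∪ E.biUnion id with hF₀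
  have hcardE : #(E.biUnion id) ≤ 6 * q := by
    refine (card_biUnion_le_card_mul E id 2 ?_).trans (by omega)
    intro e he
    obtain ⟨u, v, rfl, -⟩ := hE e he
    exact card_le_two
  have hF₀Y : ∀ Y : Finset (Fin n), Disjoint A Y → #(F₀ ∩ Y) ≤ 9 * q := by
    intro Y hY
    have : F₀ ∩ Y ⊆ X ∪ E.biUnion id := by
      intro v hv
      rw [hF₀, mem_inter, mem_union, mem_union] at hv
      rw [mem_union]
      rcases hv with ⟨(h | h) | h, hvY⟩
      · exact absurd hvY (disjoint_left.1 hY h)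
      · exact Or.inl h
      · exact Or.inr h
    exact (card_le_card this).trans ((card_union_le _ _).trans (by omega))
  have hsing : ∀ Y : Finset (Fin n), #(Y.image fun a => ({a} : Finset (Fin n))) = #Y :=
    fun Y => card_image_of_injective _ singleton_injective
  set X₁ := E ∪ X.image fun a => ({a} : Finset (Fin n)) with hX₁
  set X₂ := A.image fun a => ({a} : Finset (Fin n)) with hX₂
  have hEX : Disjoint E (X.image fun a => ({a} : Finset (Fin n))) := by
    rw [disjoint_left]
    intro e he he'
    obtain ⟨x, hx, rfl⟩ := mem_image.1 he'
    obtain ⟨u, v, -, -, h, -⟩ := hE _ he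
    exact disjoint_left.1 h (mem_singleton_self x) (mem_union_right _ hx)
  have hX₁card : #X₁ = #E + #X := by rw [hX₁, card_union_of_disjoint hEX, hsing]
  have hX₂card : #X₂ = #A := hsing A
  obtain ⟨φ₁, hφ₁, hφ₁d⟩ := exists_disjoint_completions G B C (15 * q) X₁ (by
      intro D hD F hFB hFC
      rcases mem_union.1 hD with hD | hD
      · obtain ⟨u, v, rfl, huv, -, h | h⟩ := hE D hD
        · exact exists_completion_of_edge G (X := B) huv (by omega)
        · exact exists_completion_of_edge G (X := C) huv (by omega)
      · obtain ⟨x, hx, rfl⟩ := mem_image.1 hD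
        have := hX x hx
        exact exists_completion_of_vertex G hBC hB (by omega) (by omega)) F₀
    (by have := hF₀Y B hAB; omega) (by have := hF₀Y C hAC; omega)
  set F₁ := F₀ ∪ X₁.biUnion φ₁ with hF₁
  have hF₁Y : ∀ Y : Finset (Fin n), Disjoint A Y → (∀ D ∈ X₁, #(φ₁ D ∩ Y) ≤ 1) →
      #(F₁ ∩ Y) ≤ 15 * q := by
    intro Y hY h1
    rw [hF₁, union_inter_distrib_right, biUnion_inter]
    refine (card_union_le _ _).trans ?_
    have h2 := hF₀Y Y hY
    have h3 := card_biUnion_le_card_mul X₁ (fun D => φ₁ D ∩ Y) 1 h1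
    omega
  obtain ⟨φ₂, hφ₂, hφ₂d⟩ := exists_disjoint_completions G B C (15 * q + #A) X₂ (by
      intro D hD F hFB hFC
      obtain ⟨a, ha, rfl⟩ := mem_image.1 hD
      have := hA a ha
      exact exists_completion_of_vertex G hBC hB (by omega) (by omega)) F₁
    (by have := hF₁Y B hAB fun D hD => (hφ₁ D hD).2.1; omega)
    (by have := hF₁Y C hAC fun D hD => (hφ₁ D hD).2.2.1; omega)
  have hX₁X₂ : ∀ D ∈ X₁, ∀ a ∈ A, Disjoint D {a} := by
    intro D hD a ha
    rw [disjoint_singleton_right]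
    intro haD
    rcases mem_union.1 hD with hD | hD
    · obtain ⟨u, v, -, -, h, -⟩ := hE _ hD
      exact disjoint_left.1 h haD (mem_union_left _ ha)
    · obtain ⟨x, hx, rfl⟩ := mem_image.1 hD
      rw [mem_singleton] at haD
      exact disjoint_left.1 hAX ha (haD ▸ hx)
  have hne : ∀ D ∈ X₂, D ∉ X₁ := by
    intro D hD hD'
    obtain ⟨a, ha, rfl⟩ := mem_image.1 hD
    simpa using hX₁X₂ _ hD' a ha
  have hcard : #(X₁ ∪ X₂) = #A + #X + #E := by
    rw [card_union_of_disjoint (disjoint_right.2 hne)]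
    omega
  have hXF : ∀ D ∈ X₁ ∪ X₂, D ⊆ F₀ := by
    intro D hD
    rw [hX₁, hX₂, mem_union, mem_union, mem_image, mem_image] at hD
    rcases hD with (hD | ⟨x, hx, rfl⟩) | ⟨x, hx, rfl⟩
    · exact (subset_biUnion_of_mem id hD).trans subset_union_right
    · simp [hF₀, hx]
    · simp [hF₀, hx]
  rw [← hcard]
  refine hasKDisjointTriangles_of_completions G (X₁ ∪ X₂) F₀
    (fun D => if D ∈ X₁ then φ₁ D else φ₂ D) hXF ?_ ?_ ?_
  · have : Std.Symm fun D D' : Finset (Fin n) => Disjoint D D' := ⟨fun _ _ h => h.symm⟩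
    rw [coe_union, Set.pairwise_union_of_symm]
    refine ⟨?_, ?_, ?_⟩
    · rw [hX₁, coe_union, Set.pairwise_union_of_symm]
      refine ⟨hEd, ?_, ?_⟩
      · intro D hD D' hD' h
        obtain ⟨x, hx, rfl⟩ := mem_image.1 hD
        obtain ⟨y, hy, rfl⟩ := mem_image.1 hD'
        simpa using h
      · intro D hD D' hD' h
        obtain ⟨x, hx, rfl⟩ := mem_image.1 hD'
        obtain ⟨u, v, -, -, h, -⟩ := hE _ hD
        exact h.mono_right (by simpa using Or.inr hx)
    · intro D hD D' hD' h
      obtain ⟨x, hx, rfl⟩ := mem_image.1 hD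
      obtain ⟨y, hy, rfl⟩ := mem_image.1 hD'
      simpa using h
    · intro D hD D' hD' h
      obtain ⟨a, ha, rfl⟩ := mem_image.1 hD'
      exact hX₁X₂ D hD a ha
  · intro D hD
    rcases mem_union.1 hD with hD | hD
    · simp only [hD, if_true]
      exact ⟨(hφ₁ D hD).1, (hφ₁ D hD).2.2.2⟩
    · simp only [hne D hD, if_false]
      exact ⟨(hφ₂ D hD).1.mono_right subset_union_left, (hφ₂ D hD).2.2.2⟩
  · have : Std.Symm fun D D' => Disjoint (if D ∈ X₁ then φ₁ D else φ₂ D)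
        (if D' ∈ X₁ then φ₁ D' else φ₂ D') := ⟨fun _ _ h => h.symm⟩
    rw [coe_union, Set.pairwise_union_of_symm]
    refine ⟨?_, ?_, ?_⟩
    · intro D hD D' hD' h
      simp only [mem_coe] at hD hD'
      simpa only [hD, hD', if_true] using hφ₁d hD hD' h
    · intro D hD D' hD' h
      simpa only [hne D hD, hne D' hD', if_false] using hφ₂d hD hD' h
    · intro D hD D' hD' h
      simp only [mem_coe] at hD
      simp only [hD, hne D' hD', if_true, if_false]
      exact ((hφ₂ D' hD').1.mono_right
        ((subset_biUnion_of_mem φ₁ hD).trans subset_union_right)).symm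

section Rainbow

variable {n : ℕ}

theorem HasKDisjointTriangles.hasRainbow {G : SimpleGraph (Fin n)} {k : ℕ}
    (hG : HasKDisjointTriangles G k) {χ : Sym2 (Fin n) → ℕ} (hχ : Set.InjOn χ G.edgeSet) :
    HasRainbowKTriangles (⊤ : SimpleGraph (Fin n)) χ k := by
  obtain ⟨T, hT, hcl, hd⟩ := hG
  refine ⟨T, hT, fun s hs => ⟨(hcl s hs).1.mono fun _ _ h => h.ne, (hcl s hs).2⟩, hd,
    hχ.mono ?_⟩
  rintro e ⟨hed, s, hs, hes⟩
  induction e with | _ u v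
  exact (hcl s hs).1 (hes u (by simp)) (hes v (by simp)) (by simpa using hed)

/-- A rainbow graph using all colours can be made to contain any prescribed edge by exchanging it
with the edge of the same colour. -/
theorem exists_exchange_edge {H : SimpleGraph (Fin n)} {χ : Sym2 (Fin n) → ℕ}
    (hχ : Set.InjOn χ H.edgeSet)
    (hcol : ∀ u v : Fin n, u ≠ v → ∃ h ∈ H.edgeSet, χ h = χ s(u, v)) {u v : Fin n}
    (huv : u ≠ v) : ∃ G : SimpleGraph (Fin n), Set.InjOn χ G.edgeSet ∧ G.Adj u v ∧
      (∀ X w, degIn H X w ≤ degIn G X w + 1) ∧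
      ∀ e ∈ H.edgeSet, χ e ≠ χ s(u, v) → e ∈ G.edgeSet := by
  classical
  obtain ⟨h, hh, hc⟩ := hcol u v huv
  refine ⟨SimpleGraph.fromEdgeSet (insert s(u, v) (H.edgeSet \ {h})), ?_, ?_, ?_, ?_⟩
  · rw [SimpleGraph.edgeSet_fromEdgeSet]
    refine Set.InjOn.mono Set.sdiff_subset ?_
    intro e he e' he' hee
    rcases he with rfl | ⟨he, heh⟩ <;> rcases he' with rfl | ⟨he', heh'⟩
    · rfl
    · exact absurd (hχ he' hh (by rw [hc, hee])) heh'
    · exact absurd (hχ he hh (by rw [hc, hee])) heh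
    · exact hχ he he' hee
  · simp [huv]
  · intro X w
    induction h with | _ a b
    have hsub : X.filter (H.Adj w) ⊆ insert (if w = a then b else a) (X.filter
        ((SimpleGraph.fromEdgeSet (insert s(u, v) (H.edgeSet \ {s(a, b)}))).Adj w)) := by
      intro x hx
      rw [mem_filter] at hx
      rw [mem_insert, mem_filter, SimpleGraph.fromEdgeSet_adj]
      by_cases h1 : s(w, x) = s(a, b)
      · left
        rw [Sym2.eq_iff] at h1
        rcases h1 with ⟨rfl, rfl⟩ | ⟨rfl, rfl⟩
        · simp
        · simp [hx.2.ne]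
      · exact Or.inr ⟨hx.1, Or.inr ⟨hx.2, h1⟩, hx.2.ne⟩
    refine (card_le_card hsub).trans ((card_insert_le _ _).trans (le_of_eq ?_))
    unfold degIn
    congr
  · intro e he hne
    rw [SimpleGraph.edgeSet_fromEdgeSet]
    exact ⟨Or.inr ⟨he, fun h' => hne (by rw [h', hc])⟩, H.not_isDiag_of_mem_edgeSet he⟩

theorem IsRepGraph.exists_edge_color {N : ℕ} {χ : Sym2 (Fin n) → ℕ} {H : SimpleGraph (Fin n)}
    (hH : IsRepGraph χ N H) (hχ : IsSurjColoring n N χ) {u v : Fin n} (huv : u ≠ v) :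
    ∃ h ∈ H.edgeSet, χ h = χ s(u, v) := by
  have hsub : χ '' H.edgeSet ⊆ (Finset.Icc 1 N : Set ℕ) := by
    rintro _ ⟨e, he, rfl⟩
    simpa using hχ.1 e (H.not_isDiag_of_mem_edgeSet he)
  have hcard : (χ '' H.edgeSet).ncard = (Finset.Icc 1 N : Set ℕ).ncard := by
    rw [hH.2.ncard_image, hH.1, Set.ncard_coe_finset]
    simp
  have := Set.eq_of_subset_of_ncard_le hsub hcard.ge (finite_toSet _)
  have hmem : χ s(u, v) ∈ χ '' H.edgeSet := by
    rw [this]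
    simpa using hχ.1 s(u, v) (by simpa using huv)
  exact hmem

end Rainbow

/-- A graph with many edges and bounded degree has a large matching. -/
theorem exists_matching_of_degIn_le {V : Type*} [Fintype V] [DecidableEq V] (J : SimpleGraph V)
    (d : ℕ) (hd : ∀ v, degIn J univ v ≤ d) (k : ℕ) (hk : 4 * k * d < adjPairs J univ univ) :
    ∃ E : Finset (Finset V), #E = k ∧ (∀ e ∈ E, ∃ u v, e = {u, v} ∧ J.Adj u v) ∧
      (E : Set (Finset V)).Pairwise fun e e' => Disjoint e e' := by
  classical
  induction k with
  | zero => exact ⟨∅, by simp, by simp, by simp⟩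
  | succ k ih =>
    obtain ⟨E, hE, hadj, hdis⟩ := ih (by nlinarith)
    set W := E.biUnion id with hW
    have hWcard : #W ≤ k * 2 := by
      rw [← hE]
      refine card_biUnion_le_card_mul E id 2 ?_
      intro e he
      obtain ⟨u, v, rfl, -⟩ := hadj e he
      exact card_le_two
    have hdec : adjPairs J univ univ ≤ adjPairs J Wᶜ Wᶜ + 2 * adjPairs J W univ := by
      have h1 := adjPairs_union_self J (disjoint_compl_right (a := W))
      have h2 := adjPairs_union_right J (disjoint_compl_right (a := W)) W
      rw [union_compl] at h1 h2
      omega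
    have hpos : 0 < adjPairs J Wᶜ Wᶜ := by
      have := adjPairs_le_card_mul J W univ fun v _ => hd v
      nlinarith
    obtain ⟨u, hu, hu'⟩ := exists_ne_zero_of_sum_ne_zero hpos.ne'
    obtain ⟨v, hv⟩ := card_ne_zero.1 hu'
    rw [mem_filter] at hv
    rw [mem_compl] at hu hv
    have hnew : ∀ e ∈ E, Disjoint e {u, v} := by
      intro e he
      have hsub : e ⊆ W := subset_biUnion_of_mem id he
      simp only [disjoint_insert_right, disjoint_singleton_right]
      exact ⟨fun h => hu (hsub h), fun h => hv.1 (hsub h)⟩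
    have hnot : ({u, v} : Finset V) ∉ E := fun h =>
      hu (mem_biUnion.2 ⟨_, h, by simp⟩)
    refine ⟨insert {u, v} E, by rw [card_insert_of_notMem hnot, hE], ?_, ?_⟩
    · intro e he
      rcases mem_insert.1 he with rfl | he
      · exact ⟨u, v, rfl, hv.2⟩
      · exact hadj e he
    · have : Std.Symm fun e e' : Finset V => Disjoint e e' := ⟨fun _ _ h => h.symm⟩
      rw [coe_insert, Set.pairwise_insert_of_symm_of_notMem hnot]
      exact ⟨hdis, fun e he => (hnew e he).symm⟩

theorem adjPairs_univ_le {V : Type*} [Fintype V] [DecidableEq V] (H : SimpleGraph V)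
    (A Z B C : Finset V) (hAZ : Disjoint A Z) (hAB : Disjoint (A ∪ Z) B)
    (hABC : Disjoint (A ∪ Z ∪ B) C) (huniv : A ∪ Z ∪ B ∪ C = univ) (D : ℕ)
    (hZ : ∀ z ∈ Z, degIn H (Z ∪ (B ∪ C)) z ≤ D) :
    adjPairs H univ univ + #A ≤ #A * Fintype.card V + (#Z + (#B + #C)) * #A + 2 * (#Z * D) +
      2 * (#B * #C) + (adjPairs H B B + adjPairs H C C) := by
  have hBC : Disjoint B C := (disjoint_union_left.1 hABC).2
  have hZBC : Disjoint Z (B ∪ C) := disjoint_union_right.2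
    ⟨(disjoint_union_left.1 hAB).2, (disjoint_union_left.1 (disjoint_union_left.1 hABC).1).2⟩
  have hAY : Disjoint A (Z ∪ (B ∪ C)) := disjoint_union_right.2 ⟨hAZ, disjoint_union_right.2
    ⟨(disjoint_union_left.1 hAB).1, (disjoint_union_left.1 (disjoint_union_left.1 hABC).1).1⟩⟩
  have hU : A ∪ (Z ∪ (B ∪ C)) = univ := by rw [← huniv]; simp only [union_assoc]
  have h1 : adjPairs H univ univ = adjPairs H A univ + adjPairs H (Z ∪ (B ∪ C)) A +
      adjPairs H (Z ∪ (B ∪ C)) (Z ∪ (B ∪ C)) := by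
    have hl := adjPairs_union_left H hAY univ
    have hr := adjPairs_union_right H hAY (Z ∪ (B ∪ C))
    rw [hU] at hl hr
    omega
  have h2 : adjPairs H A univ + #A ≤ #A * Fintype.card V := by
    have h : ∑ v ∈ A, (degIn H univ v + 1) ≤ #A * Fintype.card V :=
      sum_le_card_nsmul A _ _ fun v _ => degIn_add_one_le_card H (mem_univ v)
    rw [sum_add_distrib] at h
    simpa [adjPairs] using h
  have h3 := adjPairs_le_mul H (Z ∪ (B ∪ C)) A
  rw [card_union_of_disjoint hZBC, card_union_of_disjoint hBC] at h3
  have h4 : adjPairs H (Z ∪ (B ∪ C)) (Z ∪ (B ∪ C)) ≤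
      2 * adjPairs H Z (Z ∪ (B ∪ C)) + adjPairs H (B ∪ C) (B ∪ C) := by
    have h5 := adjPairs_union_self H hZBC
    have h6 := adjPairs_union_right H hZBC Z
    omega
  have h5 := adjPairs_le_card_mul H Z (Z ∪ (B ∪ C)) hZ
  have h6 := adjPairs_union_self H hBC
  have h7 := adjPairs_le_mul H B C
  omega

theorem surplus_bound {n t q j x b c D a S : ℤ} (hj : 0 ≤ j) (hx : 0 ≤ x) (hxq : x ≤ q)
    (hq : 0 < q) (hqn : 5000 * q ≤ n) (ht : 9 * t ≤ 2 * n + 3) (ha : t = a + j)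
    (hsum : a + x + b + c = n) (hD : 3 * D ≤ n - t + 76 * q)
    (hS : 2 * (t * (n - 1) + t * (n - t)) + (n - t) ^ 2 + 7 + 2 * a ≤
      2 * (a * n + (x + (b + c)) * a + 2 * (x * D) + 2 * (b * c) + S)) :
    7 + (j + x) * (600 * q) ≤ 2 * S := by
  have hbc : 4 * (b * c) ≤ (n - a - x) ^ 2 := by
    have : n - a - x = b + c := by linarith
    rw [this]
    nlinarith [sq_nonneg (b - c)]
  have hxbc : x + (b + c) = n - a := by linarith
  rw [hxbc] at hS
  subst ha
  have h1 : 7 + j * (2 * n - 2 * (a + j) - 2) + j ^ 2 + 2 * j * x - x ^ 2 + 2 * x * (n - (a + j))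
      - 4 * (x * D) ≤ 2 * S := by nlinarith
  have h2 : x * (3 * D) ≤ x * (n - (a + j) + 76 * q) := mul_le_mul_of_nonneg_left hD hx
  have h3 : x * x ≤ x * q := mul_le_mul_of_nonneg_left hxq hx
  have h4 : 0 ≤ j * x := mul_nonneg hj hx
  have h5 : j * (600 * q) ≤ j * (2 * n - 2 * (a + j) - 2) :=
    mul_le_mul_of_nonneg_left (by linarith) hj
  have h6 : x * (600 * q + q) * 3 ≤ x * (6 * (n - (a + j)) - 4 * (n - (a + j) + 76 * q)) := by
    rw [mul_assoc]
    exact mul_le_mul_of_nonneg_left (by linarith) hx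
  nlinarith [sq_nonneg j]

section Robust

variable {n : ℕ}

/-- The pair `(B, C)` spans a nearly complete bipartite subgraph of `H`, almost every vertex of `A`
is joined to almost all of `B ∪ C`, and at most `q` vertices lie outside `A ∪ B ∪ C`. -/
structure IsRobustTriple (H : SimpleGraph (Fin n)) (t q : ℕ) (A B C : Finset (Fin n)) : Prop where
  q_pos : 0 < q
  mul_q_le : 5000 * q ≤ n
  mul_t_le : 9 * t ≤ 2 * n + 3
  card_A_le : #A ≤ t + 1
  le_card_A : t ≤ #A + q
  disjoint_AB : Disjoint A B
  disjoint_AC : Disjoint A C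
  disjoint_BC : Disjoint B C
  card_B_le : 2 * #B + t ≤ n + 10 * q
  card_C_le : 2 * #C + t ≤ n + 10 * q
  le_card_B : n ≤ 2 * #B + t + 10 * q
  le_card_C : n ≤ 2 * #C + t + 10 * q
  card_rest_le : #(univ \ (A ∪ B ∪ C)) ≤ q
  degIn_B : ∀ b ∈ B, #C + 1 ≤ degIn H C b + q
  degIn_C : ∀ c ∈ C, #B + 1 ≤ degIn H B c + q
  degIn_A : ∀ a ∈ A, #B + 1 ≤ degIn H B a + q ∧ #C + 1 ≤ degIn H C a + q

namespace IsRobustTriple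

variable {H : SimpleGraph (Fin n)} {t q : ℕ} {A B C : Finset (Fin n)}

theorem hasKDisjointTriangles (h : IsRobustTriple H t q A B C) {G : SimpleGraph (Fin n)}
    (hG : ∀ X w, degIn H X w ≤ degIn G X w + 1) {Y : Finset (Fin n)} (hAY : A ⊆ Y)
    (hYt : #Y ≤ t + 1) (hY : ∀ v ∈ Y, 20 * q + 1 ≤ degIn H B v ∧ 20 * q + 1 ≤ degIn H C v)
    {E : Finset (Finset (Fin n))}
    (hE : ∀ e ∈ E, ∃ u v, e = {u, v} ∧ G.Adj u v ∧ Disjoint e Y ∧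
      (#B + 20 * q + 2 ≤ degIn H B u + degIn H B v ∨
        #C + 20 * q + 2 ≤ degIn H C u + degIn H C v))
    (hEd : (E : Set (Finset (Fin n))).Pairwise fun s₁ s₂ => Disjoint s₁ s₂) (hEq : #E ≤ 3 * q) :
    HasKDisjointTriangles G (#Y + #E) := by
  have h1 := h.q_pos
  have h2 := h.mul_q_le
  have h3 := h.mul_t_le
  have h4 := h.card_A_le
  have h5 := h.le_card_A
  have h6 := h.le_card_B
  have h7 := h.le_card_C
  have hcard : #A + #(Y \ A) = #Y := by
    rw [add_comm]; exact card_sdiff_add_card_eq_card hAY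
  have hu : A ∪ (Y \ A) = Y := union_sdiff_of_subset hAY
  rw [← hcard]
  refine hasKDisjointTriangles_of_robust G A (Y \ A) B C E q h1 h.disjoint_BC h.disjoint_AB
    h.disjoint_AC disjoint_sdiff ?_ hEd hEq (by omega) ?_ ?_ ?_ (by omega) (by omega)
  · intro e he
    obtain ⟨u, v, rfl, huv, hd, hs⟩ := hE e he
    refine ⟨u, v, rfl, huv, by rwa [hu], ?_⟩
    have b1 := hG B u
    have b2 := hG B v
    have b3 := hG C u
    have b4 := hG C v
    omega
  · intro x hx
    have b1 := hG B x
    have b2 := hG C x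
    have b3 := hY x (mem_sdiff.1 hx).1
    omega
  · intro a ha
    have b1 := hG B a
    have b2 := hG C a
    have b3 := h.degIn_A a ha
    omega
  · intro b hb
    have b1 := hG C b
    have b2 := h.degIn_B b hb
    omega

/-- The vertices with many neighbours in both `B` and `C`. -/
noncomputable def apex (H : SimpleGraph (Fin n)) (q : ℕ) (B C : Finset (Fin n)) :
    Finset (Fin n) :=
  {v | 20 * q + 1 ≤ degIn H B v ∧ 20 * q + 1 ≤ degIn H C v}

/-- The remaining vertices joined to at least two thirds of `C`. -/
noncomputable def side (H : SimpleGraph (Fin n)) (q : ℕ) (B C : Finset (Fin n)) :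
    Finset (Fin n) :=
  {v | v ∉ apex H q B C ∧ 2 * #C ≤ 3 * degIn H C v}

theorem mem_apex {v : Fin n} :
    v ∈ apex H q B C ↔ 20 * q + 1 ≤ degIn H B v ∧ 20 * q + 1 ≤ degIn H C v := by
  simp [apex]

theorem mem_side {v : Fin n} :
    v ∈ side H q B C ↔ v ∉ apex H q B C ∧ 2 * #C ≤ 3 * degIn H C v := by
  simp [side]

theorem apex_comm : apex H q B C = apex H q C B := by
  ext v
  simp only [mem_apex, and_comm]

theorem symm (h : IsRobustTriple H t q A B C) : IsRobustTriple H t q A C B where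
  q_pos := h.q_pos
  mul_q_le := h.mul_q_le
  mul_t_le := h.mul_t_le
  card_A_le := h.card_A_le
  le_card_A := h.le_card_A
  disjoint_AB := h.disjoint_AC
  disjoint_AC := h.disjoint_AB
  disjoint_BC := h.disjoint_BC.symm
  card_B_le := h.card_C_le
  card_C_le := h.card_B_le
  le_card_B := h.le_card_C
  le_card_C := h.le_card_B
  card_rest_le := by rw [union_right_comm]; exact h.card_rest_le
  degIn_B := h.degIn_C
  degIn_C := h.degIn_B
  degIn_A := fun a ha => (h.degIn_A a ha).symm

theorem subset_apex (h : IsRobustTriple H t q A B C) : A ⊆ apex H q B C := by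
  intro a ha
  have h1 := h.q_pos
  have h2 := h.mul_q_le
  have h3 := h.mul_t_le
  have h6 := h.le_card_B
  have h7 := h.le_card_C
  have h8 := h.degIn_A a ha
  rw [mem_apex]
  omega

theorem subset_apex_union_side (h : IsRobustTriple H t q A B C) :
    B ⊆ apex H q B C ∪ side H q B C := by
  intro b hb
  have h1 := h.q_pos
  have h2 := h.mul_q_le
  have h3 := h.mul_t_le
  have h7 := h.le_card_C
  have h8 := h.degIn_B b hb
  by_cases hba : b ∈ apex H q B C
  · exact mem_union_left _ hba
  · exact mem_union_right _ (mem_side.2 ⟨hba, by omega⟩)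

theorem degIn_le_of_mem_side (h : IsRobustTriple H t q A B C) {v : Fin n}
    (hv : v ∈ side H q B C) : degIn H B v ≤ 20 * q := by
  rw [mem_side, mem_apex] at hv
  have h1 := h.q_pos
  have h2 := h.mul_q_le
  have h3 := h.mul_t_le
  have h7 := h.le_card_C
  omega

theorem disjoint_side (h : IsRobustTriple H t q A B C) :
    Disjoint (side H q B C) (side H q C B) := by
  rw [disjoint_left]
  intro v hv hv'
  have h0 := h.degIn_le_of_mem_side hv
  rw [mem_side] at hv'
  have h1 := h.q_pos
  have h2 := h.mul_q_le
  have h3 := h.mul_t_le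
  have h7 := h.le_card_B
  omega

theorem side_subset (h : IsRobustTriple H t q A B C) :
    side H q B C ⊆ B ∪ univ \ (A ∪ B ∪ C) := by
  intro v hv
  simp only [mem_union, mem_sdiff, mem_univ, true_and, not_or]
  by_contra hcon
  have hvA : v ∉ A := fun hA => (mem_side.1 hv).1 (h.subset_apex hA)
  have hvC : v ∈ C := by tauto
  have h0 := h.degIn_le_of_mem_side hv
  have h8 := h.degIn_C v hvC
  have h1 := h.q_pos
  have h2 := h.mul_q_le
  have h3 := h.mul_t_le
  have h7 := h.le_card_B
  omega

theorem degIn_side_le (h : IsRobustTriple H t q A B C) {v : Fin n}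
    (hv : v ∈ side H q B C) : degIn H (side H q B C) v ≤ 21 * q := by
  have h0 := h.degIn_le_of_mem_side hv
  have h1 := (degIn_mono H h.side_subset v).trans (degIn_union_le H _ _ v)
  have h2 := degIn_le_card H (univ \ (A ∪ B ∪ C)) v
  have h3 := h.card_rest_le
  omega

theorem add_le_degIn_add_degIn_of_mem_side (h : IsRobustTriple H t q A B C) {u v : Fin n}
    (hu : u ∈ side H q B C) (hv : v ∈ side H q B C) :
    #C + 20 * q + 2 ≤ degIn H C u + degIn H C v := by
  rw [mem_side] at hu hv
  have h1 := h.q_pos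
  have h2 := h.mul_q_le
  have h3 := h.mul_t_le
  have h7 := h.le_card_C
  omega

theorem add_le_degIn_add_degIn_of_mem (h : IsRobustTriple H t q A B C) {u v : Fin n}
    (hu : u ∈ B) (hv : v ∈ B) : #C + 20 * q + 2 ≤ degIn H C u + degIn H C v := by
  have h1 := h.q_pos
  have h2 := h.mul_q_le
  have h3 := h.mul_t_le
  have h7 := h.le_card_C
  have := h.degIn_B u hu
  have := h.degIn_B v hv
  omega

/-- The vertices outside the apex set and the two sides. -/
noncomputable def rest (H : SimpleGraph (Fin n)) (q : ℕ) (B C : Finset (Fin n)) :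
    Finset (Fin n) :=
  univ \ (apex H q B C ∪ (side H q B C ∪ side H q C B))

theorem rest_subset (h : IsRobustTriple H t q A B C) :
    rest H q B C ⊆ univ \ (A ∪ B ∪ C) := by
  intro v hv
  have h1 := @subset_apex _ _ _ _ _ _ _ h v
  have h2 := @subset_apex_union_side _ _ _ _ _ _ _ h v
  have h3 := @subset_apex_union_side _ _ _ _ _ _ _ h.symm v
  simp only [rest, mem_union, mem_sdiff, mem_univ, true_and, not_or, apex_comm (B := C)] at *
  tauto

theorem degIn_rest_le (h : IsRobustTriple H t q A B C) {v : Fin n}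
    (hv : v ∈ rest H q B C) {Y : Finset (Fin n)} (hY : Disjoint A Y) :
    3 * degIn H Y v + t ≤ n + 76 * q := by
  have hYs : Y ⊆ B ∪ C ∪ univ \ (A ∪ B ∪ C) := by
    intro y hy
    have : y ∉ A := fun hA => disjoint_left.1 hY hA hy
    simp only [mem_union, mem_sdiff, mem_univ, true_and, not_or]
    tauto
  have h1 := (degIn_mono H hYs v).trans (degIn_union_le H _ _ v)
  have h2 := degIn_le_card H (univ \ (A ∪ B ∪ C)) v
  have h3 := h.card_rest_le
  have h4 := degIn_union_le H B C v
  have h5 := h.card_B_le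
  have h6 := h.card_C_le
  simp only [rest, mem_sdiff, mem_univ, true_and, mem_union, not_or] at hv
  obtain ⟨hva, hvB, hvC⟩ := hv
  have h7 : ¬ 2 * #C ≤ 3 * degIn H C v := fun h' => hvB (mem_side.2 ⟨hva, h'⟩)
  have h8 : ¬ 2 * #B ≤ 3 * degIn H B v := fun h' =>
    hvC (mem_side.2 ⟨by rwa [apex_comm], h'⟩)
  rw [mem_apex] at hva
  omega

end IsRobustTriple

end Robust

section Robust

namespace IsRobustTriple

variable {n : ℕ} {H : SimpleGraph (Fin n)} {t q : ℕ} {A B C : Finset (Fin n)}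
  {χ : Sym2 (Fin n) → ℕ}

/-- The graph of edges of `H` inside one of the two sides. -/
def sideGraph (H : SimpleGraph (Fin n)) (q : ℕ) (B C : Finset (Fin n)) :
    SimpleGraph (Fin n) where
  Adj u v := H.Adj u v ∧ ((u ∈ side H q B C ∧ v ∈ side H q B C) ∨
    (u ∈ side H q C B ∧ v ∈ side H q C B))
  symm := ⟨fun _ _ h => ⟨h.1.symm, h.2.imp And.symm And.symm⟩⟩
  loopless := ⟨fun _ h => h.1.ne rfl⟩

theorem degIn_sideGraph_le (h : IsRobustTriple H t q A B C) (v : Fin n) :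
    degIn (sideGraph H q B C) univ v ≤ 21 * q := by
  classical
  have hd := h.disjoint_side
  by_cases hv : v ∈ side H q B C
  · refine le_trans (card_le_card ?_) (h.degIn_side_le hv)
    intro w hw
    have hv' := disjoint_left.1 hd hv
    have hw := (mem_filter.1 hw).2
    refine mem_filter.2 ⟨?_, hw.1⟩
    have := hw.2
    tauto
  by_cases hv' : v ∈ side H q C B
  · refine le_trans (card_le_card ?_) (h.symm.degIn_side_le hv')
    intro w hw
    have hw := (mem_filter.1 hw).2
    refine mem_filter.2 ⟨?_, hw.1⟩
    have := hw.2
    tauto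
  · refine le_trans (le_of_eq ?_) (Nat.zero_le _)
    rw [degIn, card_eq_zero, filter_eq_empty_iff]
    intro w _ hw
    simp only [sideGraph] at hw
    tauto

theorem adjPairs_side_add_le (h : IsRobustTriple H t q A B C) :
    adjPairs H (side H q B C) (side H q B C) + adjPairs H (side H q C B) (side H q C B) ≤
      adjPairs (sideGraph H q B C) univ univ := by
  classical
  refine le_trans (add_le_add (sum_le_sum (g := degIn (sideGraph H q B C) univ) ?_)
    (sum_le_sum (g := degIn (sideGraph H q B C) univ) ?_)) ((sum_union h.disjoint_side).symm.le.trans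
    (sum_le_sum_of_subset (subset_univ _)))
  all_goals
    intro v hv
    refine card_le_card fun w hw => ?_
    have hw := mem_filter.1 hw
    refine mem_filter.2 ⟨mem_univ _, hw.2, ?_⟩
    tauto

theorem add_le_of_sideGraph_adj (h : IsRobustTriple H t q A B C) {u v : Fin n}
    (huv : (sideGraph H q B C).Adj u v) : H.Adj u v ∧
      Disjoint ({u, v} : Finset (Fin n)) (apex H q B C) ∧
      (#B + 20 * q + 2 ≤ degIn H B u + degIn H B v ∨
        #C + 20 * q + 2 ≤ degIn H C u + degIn H C v) := by
  refine ⟨huv.1, ?_, ?_⟩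
  · rw [disjoint_insert_left, disjoint_singleton_left]
    have h2 := huv.2
    simp only [mem_side, apex_comm (B := C)] at h2
    tauto
  · rcases huv.2 with hu | hu
    · exact Or.inr (h.add_le_degIn_add_degIn_of_mem_side hu.1 hu.2)
    · exact Or.inl (h.symm.add_le_degIn_add_degIn_of_mem_side hu.1 hu.2)

theorem card_apex_le (h : IsRobustTriple H t q A B C) (hχ : Set.InjOn χ H.edgeSet)
    (hcol : ∀ u v : Fin n, u ≠ v → ∃ h ∈ H.edgeSet, χ h = χ s(u, v))
    (hno : ¬ HasRainbowKTriangles (⊤ : SimpleGraph (Fin n)) χ (t + 2)) :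
    #(apex H q B C) ≤ t := by
  by_contra! hcon
  obtain ⟨Y, hAY, hY, hYc⟩ := exists_subsuperset_card_eq h.subset_apex h.card_A_le hcon
  have h1 := h.q_pos
  have h2 := h.mul_q_le
  have h3 := h.mul_t_le
  have h7 := h.le_card_B
  obtain ⟨b, hb, b', hb', hne⟩ := one_lt_card.1 (show 1 < #(B \ Y) by
    have := le_card_sdiff Y B
    omega)
  rw [mem_sdiff] at hb hb'
  obtain ⟨G, hGχ, hGb, hG, -⟩ := exists_exchange_edge hχ hcol hne
  refine hno (HasKDisjointTriangles.hasRainbow ?_ hGχ)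
  have := h.hasKDisjointTriangles hG hAY hYc.le (fun v hv => mem_apex.1 (hY hv))
    (E := {{b, b'}}) (by
      simp only [mem_singleton, forall_eq]
      refine ⟨b, b', rfl, hGb, ?_, Or.inr (h.add_le_degIn_add_degIn_of_mem hb.1 hb'.1)⟩
      rw [disjoint_insert_left, disjoint_singleton_left]
      exact ⟨hb.2, hb'.2⟩) (by simp) (by rw [card_singleton]; omega)
  rwa [hYc, card_singleton] at this

theorem exists_sideGraph_surplus (h : IsRobustTriple H t q A B C)
    (hA : #(apex H q B C) ≤ t)
    (hP : 2 * ((t : ℤ) * (n - 1) + t * (n - t)) + (n - t) ^ 2 + 7 ≤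
      2 * (adjPairs H univ univ : ℤ)) :
    7 + (t - #(apex H q B C)) * (600 * q) ≤ 2 * adjPairs (sideGraph H q B C) univ univ := by
  have h1 := h.q_pos
  have h2 := h.mul_q_le
  have h3 := h.mul_t_le
  have hx := (card_le_card h.rest_subset).trans h.card_rest_le
  have hdAB : Disjoint (apex H q B C) (side H q B C) :=
    disjoint_right.2 fun v hv => (mem_side.1 hv).1
  have hdAC : Disjoint (apex H q B C) (side H q C B) :=
    disjoint_right.2 fun v hv => by rw [apex_comm]; exact (mem_side.1 hv).1
  have hdR : Disjoint (rest H q B C) (apex H q B C ∪ (side H q B C ∪ side H q C B)) :=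
    sdiff_disjoint
  have hdRA := (disjoint_union_right.1 hdR).1
  have hdRB := (disjoint_union_right.1 (disjoint_union_right.1 hdR).2).1
  have hdRC := (disjoint_union_right.1 (disjoint_union_right.1 hdR).2).2
  have hu : apex H q B C ∪ rest H q B C ∪ side H q B C ∪ side H q C B = univ := by
    ext v
    simp only [rest, mem_union, mem_sdiff, mem_univ, true_and, iff_true]
    tauto
  have hd2 : Disjoint (apex H q B C ∪ rest H q B C) (side H q B C) :=
    disjoint_union_left.2 ⟨hdAB, hdRB⟩
  have hd3 : Disjoint (apex H q B C ∪ rest H q B C ∪ side H q B C) (side H q C B) :=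
    disjoint_union_left.2 ⟨disjoint_union_left.2 ⟨hdAC, hdRC⟩, h.disjoint_side⟩
  have hc := congrArg card hu
  rw [card_univ, Fintype.card_fin, card_union_of_disjoint hd3, card_union_of_disjoint hd2,
    card_union_of_disjoint hdRA.symm] at hc
  obtain ⟨D, hD⟩ : ∃ D, D = (n + 76 * q - t) / 3 := ⟨_, rfl⟩
  have hmain := adjPairs_univ_le H _ _ _ _ hdRA.symm hd2 hd3 hu D
    fun z hz => by
      have := h.degIn_rest_le hz (Y := rest H q B C ∪ (side H q B C ∪ side H q C B))
        (Disjoint.mono_left h.subset_apex (disjoint_union_right.2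
          ⟨hdRA.symm, disjoint_union_right.2 ⟨hdAB, hdAC⟩⟩))
      omega
  rw [Fintype.card_fin] at hmain
  have hS := h.adjPairs_side_add_le
  obtain ⟨j, hj⟩ := Nat.exists_eq_add_of_le hA
  zify at hmain hS hc
  have := surplus_bound (t := t) (n := n) (q := q) (j := j) (x := #(rest H q B C))
    (a := #(apex H q B C)) (b := #(side H q B C)) (c := #(side H q C B))
    (D := D) (S := adjPairs (sideGraph H q B C) univ univ)
    (by omega) (by omega) (by omega) (by omega) (by omega) (by omega) (by omega) (by omega)
    (by omega) (by linarith)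
  have hj' : t - #(apex H q B C) = j := by omega
  rw [hj']
  zify
  nlinarith

/-- A graph close to the extremal one with two edges more than the extremal number has a
rainbow-extendable family of `t + 2` disjoint triangles. -/
theorem contradiction (h : IsRobustTriple H t q A B C) (hχ : Set.InjOn χ H.edgeSet)
    (hcol : ∀ u v : Fin n, u ≠ v → ∃ h ∈ H.edgeSet, χ h = χ s(u, v))
    (hno : ¬ HasRainbowKTriangles (⊤ : SimpleGraph (Fin n)) χ (t + 2))
    (hP : 2 * ((t : ℤ) * (n - 1) + t * (n - t)) + (n - t) ^ 2 + 7 ≤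
      2 * (adjPairs H univ univ : ℤ)) : False := by
  have hA := h.card_apex_le hχ hcol hno
  have hS := h.exists_sideGraph_surplus hA hP
  have h1 := h.q_pos
  have h2 := h.mul_q_le
  have h3 := h.mul_t_le
  have h4 := card_le_card h.subset_apex
  have h5 := h.le_card_A
  have h7 := h.le_card_B
  obtain hlt | heq := hA.lt_or_eq
  · obtain ⟨E, hEc, hE, hEd⟩ := exists_matching_of_degIn_le (sideGraph H q B C) (21 * q)
      h.degIn_sideGraph_le (t + 2 - #(apex H q B C)) (by
        obtain ⟨j, hj⟩ := Nat.exists_eq_add_of_lt hlt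
        have e1 : t - #(apex H q B C) = j + 1 := by omega
        have e2 : t + 2 - #(apex H q B C) = j + 3 := by omega
        rw [e1] at hS
        rw [e2]
        nlinarith)
    refine hno (HasKDisjointTriangles.hasRainbow ?_ hχ)
    have := h.hasKDisjointTriangles (G := H) (fun _ _ => Nat.le_succ _) h.subset_apex (by omega)
      (fun v hv => mem_apex.1 hv) (E := E) (fun e he => by
        obtain ⟨u, v, rfl, huv⟩ := hE e he
        obtain ⟨a, b, c⟩ := h.add_le_of_sideGraph_adj huv
        exact ⟨u, v, rfl, a, b, c⟩) hEd (by omega)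
    rwa [hEc, Nat.add_sub_of_le (by omega)] at this
  · have hcardE : 1 < (sideGraph H q B C).edgeSet.ncard := by
      have := two_mul_ncard_edgeSet (sideGraph H q B C)
      omega
    obtain ⟨e₁, e₂, he₁, he₂, hne⟩ := (Set.one_lt_ncard_iff (Set.toFinite _)).1 hcardE
    have hle : ∀ e ∈ (sideGraph H q B C).edgeSet, e ∈ H.edgeSet := by
      intro e he
      induction e with | _ u v
      exact he.1
    have hcol2 : χ e₁ ≠ χ e₂ := fun hh => hne (hχ (hle _ he₁) (hle _ he₂) hh)
    obtain ⟨d, hd, d', hd', hdd⟩ := one_lt_card.1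
      (show 1 < #(B \ (apex H q B C ∪ (e₁.toFinset ∪ e₂.toFinset))) by
        have a1 := le_card_sdiff (apex H q B C ∪ (e₁.toFinset ∪ e₂.toFinset)) B
        have a2 := card_union_le (apex H q B C) (e₁.toFinset ∪ e₂.toFinset)
        have a3 := card_union_le e₁.toFinset e₂.toFinset
        have a4 := Sym2.card_toFinset e₁
        have a5 := Sym2.card_toFinset e₂
        split_ifs at a4 a5 <;> omega)
    obtain ⟨G, hGχ, hGd, hG, hGe⟩ := exists_exchange_edge hχ hcol hdd
    simp only [mem_sdiff, mem_union, not_or] at hd hd'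
    obtain ⟨e, he, heG, hed, hed'⟩ : ∃ e ∈ (sideGraph H q B C).edgeSet, e ∈ G.edgeSet ∧
        d ∉ e.toFinset ∧ d' ∉ e.toFinset := by
      by_cases hc : χ e₁ = χ s(d, d')
      · exact ⟨e₂, he₂, hGe _ (hle _ he₂) (by rw [← hc]; exact hcol2.symm), hd.2.2.2, hd'.2.2.2⟩
      · exact ⟨e₁, he₁, hGe _ (hle _ he₁) hc, hd.2.2.1, hd'.2.2.1⟩
    induction e with | _ u v
    obtain ⟨-, hY, hs⟩ := h.add_le_of_sideGraph_adj he
    simp only [Sym2.mem_toFinset, Sym2.mem_iff, not_or] at hed hed'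
    have hdisj : Disjoint ({u, v} : Finset (Fin n)) {d, d'} := by
      simp only [disjoint_insert_left, disjoint_singleton_left, mem_insert, mem_singleton, not_or]
      tauto
    have hEne : ({u, v} : Finset (Fin n)) ≠ {d, d'} := by
      intro hh
      rw [hh, disjoint_self] at hdisj
      exact insert_ne_empty _ _ hdisj
    refine hno (HasKDisjointTriangles.hasRainbow ?_ hGχ)
    have := h.hasKDisjointTriangles hG h.subset_apex (by omega)
      (fun v hv => mem_apex.1 hv) (E := {{u, v}, {d, d'}}) (by
        simp only [mem_insert, mem_singleton, forall_eq_or_imp, forall_eq]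
        refine ⟨⟨u, v, rfl, heG, hY, hs⟩, d, d', rfl, hGd, ?_,
          Or.inr (h.add_le_degIn_add_degIn_of_mem hd.1 hd'.1)⟩
        rw [disjoint_insert_left, disjoint_singleton_left]
        exact ⟨hd.2.1, hd'.2.1⟩) (by
        rw [coe_pair]
        have : Std.Symm fun a b : Finset (Fin n) => Disjoint a b := ⟨fun _ _ h => h.symm⟩
        exact (Set.pairwise_pair_of_symm).2 fun _ => hdisj) (by rw [card_pair hEne]; omega)
    rwa [card_pair hEne, heq] at this

end IsRobustTriple

end Robust

section Extremal

variable {n : ℕ}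

/-- The join of a complete graph on `A` with the complete bipartite graph with parts `B` and
`univ \ (A ∪ B)`. -/
def joinBipartite (A B : Finset (Fin n)) : SimpleGraph (Fin n) where
  Adj u v := u ≠ v ∧ (u ∈ A ∨ v ∈ A ∨ (u ∈ B ↔ v ∉ B))
  symm := ⟨fun _ _ h => ⟨h.1.symm, by tauto⟩⟩
  loopless := ⟨fun _ h => h.1 rfl⟩

theorem not_hasKDisjointTriangles_joinBipartite (A B : Finset (Fin n)) :
    ¬ HasKDisjointTriangles (joinBipartite A B) (#A + 1) := by
  rintro ⟨T, hT, hcl, hd⟩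
  have hex : ∀ s ∈ T, ∃ a ∈ s, a ∈ A := by
    intro s hs
    obtain ⟨x, y, z, hxy, hxz, hyz, rfl⟩ := SimpleGraph.is3Clique_iff.1 (hcl s hs)
    simp only [joinBipartite] at hxy hxz hyz
    simp only [mem_insert, mem_singleton, exists_eq_or_imp, exists_eq_left]
    tauto
  choose f hfs hfA using hex
  have := card_le_card_of_injOn (s := T.attach) (t := A) (fun s => f s.1 s.2)
    (fun s _ => hfA s.1 s.2) fun s _ s' _ h => by
      by_contra hne
      exact disjoint_left.1 (hd s.2 s'.2 fun h' => hne (Subtype.ext h')) (hfs s.1 s.2)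
        ((show f s.1 s.2 = f s'.1 s'.2 from h) ▸ hfs s'.1 s'.2)
  rw [card_attach] at this
  omega

theorem ncard_edgeSet_le_exTriangles {G : SimpleGraph (Fin n)} {k : ℕ}
    (h : ¬ HasKDisjointTriangles G k) : G.edgeSet.ncard ≤ exTriangles n k := by
  refine le_csSup ⟨n * n, ?_⟩ ⟨G, h, rfl⟩
  rintro _ ⟨H, -, rfl⟩
  have h1 := two_mul_ncard_edgeSet H
  have h2 := adjPairs_le_mul H univ univ
  rw [card_univ, Fintype.card_fin] at h2
  omega

theorem le_exTriangles {t : ℕ} (ht : t ≤ n) :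
    2 * ((t : ℤ) * (n - 1) + t * (n - t)) + (n - t) ^ 2 ≤ 4 * exTriangles n (t + 1) + 1 := by
  classical
  obtain ⟨A, -, hA⟩ := exists_subset_card_eq (s := (univ : Finset (Fin n))) (n := t) (by simpa)
  have hAc : #(univ \ A) = n - t := by
    rw [card_sdiff_of_subset (subset_univ _), card_univ, Fintype.card_fin, hA]
  obtain ⟨B, hBA, hB⟩ := exists_subset_card_eq (s := univ \ A) (n := (n - t) / 2) (by omega)
  have hC : #((univ \ A) \ B) = n - t - (n - t) / 2 := by
    rw [card_sdiff_of_subset hBA, hAc, hB]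
  have hdAB : Disjoint A B := disjoint_of_subset_right hBA disjoint_sdiff
  have hdC : Disjoint A ((univ \ A) \ B) := disjoint_of_subset_right sdiff_subset disjoint_sdiff
  have hdBC : Disjoint B ((univ \ A) \ B) := disjoint_sdiff
  have hu : A ∪ (B ∪ (univ \ A) \ B) = univ := by
    rw [union_sdiff_of_subset hBA, union_sdiff_of_subset (subset_univ _)]
  generalize (univ \ A) \ B = C at *
  have h1 := two_mul_ncard_edgeSet (joinBipartite A B)
  have h2 := ncard_edgeSet_le_exTriangles (not_hasKDisjointTriangles_joinBipartite A B)
  have hdA : ∀ v ∈ A, n - 1 ≤ degIn (joinBipartite A B) univ v := by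
    intro v hv
    refine le_trans (le_of_eq ?_) (card_le_card (s := univ.erase v) ?_)
    · rw [card_erase_of_mem (mem_univ _), card_univ, Fintype.card_fin]
    · intro w hw
      exact mem_filter.2 ⟨mem_univ _, (ne_of_mem_erase hw).symm, Or.inl hv⟩
  have hdB : ∀ v ∈ B, t + #C ≤ degIn (joinBipartite A B) univ v := by
    intro v hv
    rw [← hA, ← card_union_of_disjoint hdC]
    refine card_le_card fun w hw => mem_filter.2 ⟨mem_univ _, ?_⟩
    have ha : v ∈ A → v ∉ B := fun h => disjoint_left.1 hdAB h
    have hb : v ∈ B → v ∉ C := fun h => disjoint_left.1 hdBC h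
    have hc : w ∈ B → w ∉ C := fun h => disjoint_left.1 hdBC h
    rw [mem_union] at hw
    refine ⟨?_, by tauto⟩
    rintro rfl
    tauto
  have hdC' : ∀ v ∈ C, t + #B ≤ degIn (joinBipartite A B) univ v := by
    intro v hv
    rw [← hA, ← card_union_of_disjoint hdAB]
    refine card_le_card fun w hw => mem_filter.2 ⟨mem_univ _, ?_⟩
    have ha : v ∈ A → v ∉ C := fun h => disjoint_left.1 hdC h
    have hb : v ∈ B → v ∉ C := fun h => disjoint_left.1 hdBC h
    rw [mem_union] at hw
    refine ⟨?_, by tauto⟩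
    rintro rfl
    tauto
  have h3 : t * (n - 1) + (#B * (t + #C) + #C * (t + #B)) ≤
      adjPairs (joinBipartite A B) univ univ := by
    have e1 := adjPairs_union_left (joinBipartite A B) (disjoint_union_right.2 ⟨hdAB, hdC⟩) univ
    rw [hu, adjPairs_union_left _ hdBC] at e1
    have e2 := card_nsmul_le_sum A _ _ hdA
    have e3 := card_nsmul_le_sum B _ _ hdB
    have e4 := card_nsmul_le_sum C _ _ hdC'
    rw [smul_eq_mul] at e2 e3 e4
    rw [hA] at e2
    rw [e1]
    exact add_le_add e2 (add_le_add e3 e4)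
  rw [hA] at h2
  obtain ⟨k, rfl⟩ := Nat.exists_eq_add_of_le ht
  rw [Nat.add_sub_cancel_left] at hB hC
  rw [hB, hC] at h3
  have h4 : 2 * (t * (t + k - 1) + (k / 2 * (t + (k - k / 2)) + (k - k / 2) * (t + k / 2))) ≤
      4 * exTriangles (t + k) (t + 1) := by omega
  obtain h0 | htpos := Nat.eq_zero_or_pos (t + k)
  · obtain ⟨h5, h6⟩ : t = 0 ∧ k = 0 := by omega
    simp only [h5, h6]
    norm_num
    positivity
  obtain ⟨i, hi⟩ := Nat.even_or_odd' k
  obtain hi | hi := hi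
  · have e1 : k / 2 = i := by omega
    have e2 : k - i = i := by omega
    rw [e1, e2] at h4
    zify [show 1 ≤ t + k from htpos] at h4
    subst hi
    push_cast at h4 ⊢
    nlinarith
  · have e1 : k / 2 = i := by omega
    have e2 : k - i = i + 1 := by omega
    rw [e1, e2] at h4
    zify [show 1 ≤ t + k from htpos] at h4
    subst hi
    push_cast at h4 ⊢
    nlinarith

end Extremal

section Tiling

variable {n : ℕ} {H : SimpleGraph (Fin n)} {T M : Finset (Finset (Fin n))} {I : Finset (Fin n)}

theorem exists_isTilingTriple {T' : Finset (Finset (Fin n))}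
    (hcl : ∀ s ∈ T', H.IsNClique 3 s)
    (hd : (T' : Set (Finset (Fin n))).Pairwise fun s₁ s₂ => Disjoint s₁ s₂) :
    ∃ M' I', IsTilingTriple H T' M' I' := by
  classical
  obtain ⟨M', hM', hmax⟩ := exists_max_image
    (univ.filter fun M' : Finset (Finset (Fin n)) => (∀ e ∈ M', H.IsNClique 2 e) ∧
      (((T' ∪ M' : Finset (Finset (Fin n))) : Set (Finset (Fin n))).Pairwise
        fun s₁ s₂ => Disjoint s₁ s₂)) card ⟨∅, by simpa using hd⟩
  rw [mem_filter] at hM'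
  obtain ⟨-, hcl', hd'⟩ := hM'
  refine ⟨M', univ \ (T' ∪ M').biUnion id, hcl, hcl', ?_, hd', disjoint_sdiff,
    union_sdiff_of_subset (subset_univ _)⟩
  intro a ha b hb hab
  have hnew : ∀ s ∈ T' ∪ M', Disjoint ({a, b} : Finset (Fin n)) s := by
    intro s hs
    rw [disjoint_insert_left, disjoint_singleton_left]
    exact ⟨fun h => (mem_sdiff.1 ha).2 (mem_biUnion.2 ⟨s, hs, h⟩),
      fun h => (mem_sdiff.1 hb).2 (mem_biUnion.2 ⟨s, hs, h⟩)⟩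
  have hnot : ({a, b} : Finset (Fin n)) ∉ T' ∪ M' := fun h => by
    have := hnew _ h
    rw [disjoint_self] at this
    exact insert_ne_empty _ _ this
  have := hmax (insert {a, b} M') (mem_filter.2 ⟨mem_univ _, ?_, ?_⟩)
  · rw [card_insert_of_notMem fun h => hnot (mem_union_right _ h)] at this
    omega
  · intro e he
    rw [mem_insert] at he
    obtain rfl | he := he
    · rw [SimpleGraph.isNClique_iff, card_pair hab.ne]
      refine ⟨?_, rfl⟩
      rw [coe_pair, SimpleGraph.isClique_pair]
      exact fun _ => hab
    · exact hcl' e he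
  · rw [union_insert, coe_insert]
    have : Std.Symm fun a b : Finset (Fin n) => Disjoint a b := ⟨fun _ _ h => h.symm⟩
    exact (Set.pairwise_insert_of_symm_of_notMem hnot).2 ⟨hd', fun s hs => hnew s hs⟩

theorem IsMaxTilingTriple.card_le (h : IsMaxTilingTriple H T M I)
    {T' : Finset (Finset (Fin n))} (hcl : ∀ s ∈ T', H.IsNClique 3 s)
    (hd : (T' : Set (Finset (Fin n))).Pairwise fun s₁ s₂ => Disjoint s₁ s₂) : #T' ≤ #T := by
  obtain ⟨M', I', h'⟩ := exists_isTilingTriple hcl hd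
  have := h.2 _ _ _ h'
  omega

theorem IsMaxTilingTriple.card_exchange_le (h : IsMaxTilingTriple H T M I)
    {S Q : Finset (Finset (Fin n))} (hS : S ⊆ T) (hcl : ∀ s ∈ Q, H.IsNClique 3 s)
    (hd : (Q : Set (Finset (Fin n))).Pairwise fun s₁ s₂ => Disjoint s₁ s₂)
    (hQ : ∀ q ∈ Q, ∀ s ∈ T, s ∉ S → Disjoint q s) : #Q ≤ #S := by
  have hTd := h.1.2.2.2.1
  have hdisj : Disjoint (T \ S) Q := by
    rw [disjoint_right]
    intro q hq hqT
    rw [mem_sdiff] at hqT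
    have := hQ q hq q hqT.1 hqT.2
    rw [disjoint_self] at this
    have hc := (hcl q hq).2
    rw [this] at hc
    simp at hc
  have := h.card_le (T' := T \ S ∪ Q) (by
    intro s hs
    rw [mem_union, mem_sdiff] at hs
    exact hs.elim (fun h' => h.1.1 s h'.1) (hcl s)) (by
    have : Std.Symm fun a b : Finset (Fin n) => Disjoint a b := ⟨fun _ _ h => h.symm⟩
    rw [coe_union, Set.pairwise_union_of_symm]
    refine ⟨hTd.mono fun s hs => ?_, hd, fun s hs q hq _ => ?_⟩
    · rw [mem_coe, mem_sdiff] at hs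
      exact mem_coe.2 (mem_union_left _ hs.1)
    · rw [mem_coe, mem_sdiff] at hs
      exact (hQ q hq s hs.1 hs.2).symm)
  rw [card_union_of_disjoint hdisj, card_sdiff_of_subset hS] at this
  have := card_le_card hS
  omega

theorem IsTilingTriple.disjoint_of_mem (h : IsTilingTriple H T M I) {s e : Finset (Fin n)}
    (hs : s ∈ T) (he : e ∈ M) : Disjoint s e := by
  refine h.2.2.2.1 (mem_coe.2 (mem_union_left _ hs)) (mem_coe.2 (mem_union_right _ he)) ?_
  rintro rfl
  have h1 := (h.1 s hs).2
  have h2 := (h.2.1 s he).2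
  omega

theorem isNClique_three_insert {e s : Finset (Fin n)} {w : Fin n} (he : H.IsNClique 2 e)
    (h : seesAt H e s w) : H.IsNClique 3 (insert w e) :=
  he.insert fun u hu => (h.2 u hu).symm

open Classical in
/-- The edges of `M` seeing the vertex `w` of the triangle `s`. -/
noncomputable def seeing (H : SimpleGraph (Fin n)) (M : Finset (Finset (Fin n)))
    (s : Finset (Fin n)) (w : Fin n) : Finset (Finset (Fin n)) :=
  {e ∈ M | seesAt H e s w}

theorem mem_seeing {e s : Finset (Fin n)} {w : Fin n} :
    e ∈ seeing H M s w ↔ e ∈ M ∧ seesAt H e s w := by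
  simp [seeing]

theorem IsMaxTilingTriple.exists_two_le_card_seeing (h : IsMaxTilingTriple H T M I)
    {s : Finset (Fin n)} (hs : s ∈ T)
    (h2 : ∃ e₁ ∈ M, ∃ e₂ ∈ M, e₁ ≠ e₂ ∧ sees H e₁ s ∧ sees H e₂ s) :
    ∃ w ∈ s, 2 ≤ #(seeing H M s w) := by
  obtain ⟨e₁, he₁, e₂, he₂, hne, ⟨w₁, hw₁⟩, w₂, hw₂⟩ := h2
  obtain rfl | hw := eq_or_ne w₁ w₂
  · exact ⟨w₁, hw₁.1, one_lt_card.2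
      ⟨e₁, mem_seeing.2 ⟨he₁, hw₁⟩, e₂, mem_seeing.2 ⟨he₂, hw₂⟩, hne⟩⟩
  exfalso
  have hTd := h.1.2.2.2.1
  have hd1 := h.1.disjoint_of_mem hs he₁
  have hd2 := h.1.disjoint_of_mem hs he₂
  have hd12 : Disjoint e₁ e₂ :=
    hTd (mem_coe.2 (mem_union_right _ he₁)) (mem_coe.2 (mem_union_right _ he₂)) hne
  have hdisj : Disjoint (insert w₁ e₁) (insert w₂ e₂) := by
    rw [disjoint_insert_left, disjoint_insert_right, mem_insert, not_or]
    exact ⟨⟨hw, disjoint_left.1 hd2 hw₁.1⟩, disjoint_left.1 hd1 hw₂.1, hd12⟩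
  have hne' : insert w₁ e₁ ≠ insert w₂ e₂ := fun h' => by
    rw [h', disjoint_self] at hdisj
    exact insert_ne_empty _ _ hdisj
  have := h.card_exchange_le (S := {s}) (Q := {insert w₁ e₁, insert w₂ e₂})
    (singleton_subset_iff.2 hs) (by
      simp only [mem_insert, mem_singleton, forall_eq_or_imp, forall_eq]
      exact ⟨isNClique_three_insert (h.1.2.1 _ he₁) hw₁,
        isNClique_three_insert (h.1.2.1 _ he₂) hw₂⟩) (by
      rw [coe_pair]
      have : Std.Symm fun a b : Finset (Fin n) => Disjoint a b := ⟨fun _ _ h => h.symm⟩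
      exact (Set.pairwise_pair_of_symm).2 fun _ => hdisj) (by
      simp only [mem_insert, mem_singleton, forall_eq_or_imp, forall_eq]
      refine ⟨fun s' hs' hss => ?_, fun s' hs' hss => ?_⟩
      all_goals
        have hds : Disjoint s s' := hTd (mem_coe.2 (mem_union_left _ hs))
          (mem_coe.2 (mem_union_left _ hs')) (Ne.symm hss)
        rw [disjoint_insert_left]
      · exact ⟨disjoint_left.1 hds hw₁.1, (h.1.disjoint_of_mem hs' he₁).symm⟩
      · exact ⟨disjoint_left.1 hds hw₂.1, (h.1.disjoint_of_mem hs' he₂).symm⟩)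
  rw [card_pair hne', card_singleton] at this
  omega

/-- No triangle avoiding the distinguished vertices can be completed to an improved tiling. -/
theorem IsMaxTilingTriple.not_isNClique_three (h : IsMaxTilingTriple H T M I)
    {x : Finset (Fin n) → Fin n} {S : Finset (Finset (Fin n))} (hS : S ⊆ T)
    {τ : Finset (Fin n)}
    (hτ : τ ⊆ M.biUnion id ∪ S.biUnion fun s => s.erase (x s))
    (hx : ∀ s ∈ S, x s ∈ s)
    (hsee : ∀ s ∈ S, #S ≤ #{e ∈ seeing H M s (x s) | Disjoint e τ}) :
    ¬ H.IsNClique 3 τ := by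
  intro hcl
  have hTd := h.1.2.2.2.1
  have hST : ∀ s ∈ S, ∀ s' ∈ T, s ≠ s' → Disjoint s s' := fun s hs s' hs' hne =>
    hTd (mem_coe.2 (mem_union_left _ (hS hs))) (mem_coe.2 (mem_union_left _ hs')) hne
  obtain ⟨f, hf, hfm⟩ := (all_card_le_biUnion_card_iff_exists_injective
    fun s : S => {e ∈ seeing H M s.1 (x s) | Disjoint e τ}).1 (by
      intro S'
      obtain rfl | ⟨s, hs⟩ := S'.eq_empty_or_nonempty
      · simp
      · refine ((card_le_univ S').trans ?_).trans
          (card_le_card (subset_biUnion_of_mem _ hs))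
        rw [Fintype.card_coe]
        exact hsee s.1 s.2)
  simp only [mem_filter, mem_seeing] at hfm
  have hxf : ∀ s s' : S, x s ∉ f s' := fun s s' =>
    disjoint_left.1 (h.1.disjoint_of_mem (hS s.2) (hfm s').1.1) (hx s s.2)
  have hxτ : ∀ s : S, x s ∉ τ := by
    intro s hs
    obtain hs | hs := mem_union.1 (hτ hs)
    · obtain ⟨e, he, hse⟩ := mem_biUnion.1 hs
      exact disjoint_left.1 (h.1.disjoint_of_mem (hS s.2) he) (hx s s.2) hse
    · obtain ⟨s', hs', hss'⟩ := mem_biUnion.1 hs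
      rw [mem_erase] at hss'
      obtain heq | hne := eq_or_ne s.1 s'
      · exact hss'.1 (heq ▸ rfl)
      · exact disjoint_left.1 (hST s s.2 s' (hS hs') hne) (hx s s.2) hss'.2
  have hdis : ∀ s s' : S, s ≠ s' → Disjoint (insert (x s) (f s)) (insert (x s') (f s')) := by
    intro s s' hne
    rw [disjoint_insert_left, disjoint_insert_right, mem_insert, not_or]
    refine ⟨⟨fun heq => ?_, hxf s s'⟩, hxf s' s, ?_⟩
    · exact disjoint_left.1 (hST s s.2 s' (hS s'.2) fun h' => hne (Subtype.ext h')) (hx s s.2)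
        (heq ▸ hx s' s'.2)
    · exact hTd (mem_coe.2 (mem_union_right _ (hfm s).1.1))
        (mem_coe.2 (mem_union_right _ (hfm s').1.1)) fun h' => hne (hf h')
  have hdisτ : ∀ s : S, Disjoint τ (insert (x s) (f s)) := by
    intro s
    rw [disjoint_insert_right]
    exact ⟨hxτ s, (hfm s).2.symm⟩
  have hinj : Function.Injective fun s : S => insert (x s) (f s) := by
    intro s s' heq
    by_contra hne
    have := hdis s s' hne
    rw [show insert (x s) (f s) = insert (x s') (f s') from heq, disjoint_self] at this
    exact insert_ne_empty _ _ this
  have hτn : τ ∉ univ.image fun s : S => insert (x s) (f s) := by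
    intro hm
    obtain ⟨s, -, hs⟩ := mem_image.1 hm
    have := hdisτ s
    rw [hs, disjoint_self] at this
    have hc := hcl.2
    rw [this] at hc
    simp at hc
  have := h.card_exchange_le (S := S)
    (Q := insert τ (univ.image fun s : S => insert (x s) (f s))) hS (by
      intro q hq
      rw [mem_insert, mem_image] at hq
      obtain rfl | ⟨s, -, rfl⟩ := hq
      · exact hcl
      · exact isNClique_three_insert (h.1.2.1 _ (hfm s).1.1) (hfm s).1.2) (by
      have : Std.Symm fun a b : Finset (Fin n) => Disjoint a b := ⟨fun _ _ h => h.symm⟩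
      rw [coe_insert]
      refine (Set.pairwise_insert_of_symm_of_notMem hτn).2 ⟨?_, ?_⟩
      · rw [coe_image, coe_univ, Set.image_univ]
        rintro _ ⟨s, rfl⟩ _ ⟨s', rfl⟩ hne
        exact hdis s s' fun h' => hne (h' ▸ rfl)
      · intro q hq
        obtain ⟨s, -, rfl⟩ := mem_image.1 hq
        exact hdisτ s) (by
      intro q hq s' hs' hs'S
      have hne : ∀ s : S, s.1 ≠ s' := fun s heq => hs'S (heq ▸ s.2)
      rw [mem_insert, mem_image] at hq
      obtain rfl | ⟨s, -, rfl⟩ := hq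
      · rw [disjoint_left]
        intro v hv hvs
        obtain hv | hv := mem_union.1 (hτ hv)
        · obtain ⟨e, he, hve⟩ := mem_biUnion.1 hv
          exact disjoint_left.1 (h.1.disjoint_of_mem hs' he) hvs hve
        · obtain ⟨s, hs, hvs'⟩ := mem_biUnion.1 hv
          exact disjoint_left.1 (hST s hs s' hs' (hne ⟨s, hs⟩)) (mem_of_mem_erase hvs') hvs
      · rw [disjoint_insert_left]
        exact ⟨disjoint_left.1 (hST s s.2 s' hs' (hne s)) (hx s s.2),
          (h.1.disjoint_of_mem hs' (hfm s).1.1).symm⟩)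
  rw [card_insert_of_notMem hτn, card_image_of_injective _ hinj, card_univ,
    Fintype.card_coe] at this
  omega

end Tiling

section Frame

variable {n : ℕ} {H : SimpleGraph (Fin n)} {T M : Finset (Finset (Fin n))} {I : Finset (Fin n)}
  {S : Finset (Finset (Fin n))} {x : Finset (Fin n) → Fin n}

theorem card_filter_not_disjoint_le {F : Finset (Finset (Fin n))}
    (hF : (F : Set (Finset (Fin n))).Pairwise fun s₁ s₂ => Disjoint s₁ s₂)
    (τ : Finset (Fin n)) : #{s ∈ F | ¬ Disjoint s τ} ≤ #τ := by
  have hex : ∀ s ∈ {s ∈ F | ¬ Disjoint s τ}, ∃ v, v ∈ s ∧ v ∈ τ := by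
    intro s hs
    obtain ⟨v, hv, hv'⟩ := not_disjoint_iff.1 (mem_filter.1 hs).2
    exact ⟨v, hv, hv'⟩
  choose f hf hfτ using hex
  rw [← card_attach]
  refine card_le_card_of_injOn (fun s => f s.1 s.2) (fun s _ => hfτ s.1 s.2) fun s _ s' _ h => ?_
  by_contra hne
  exact disjoint_left.1 (hF (mem_filter.1 s.2).1 (mem_filter.1 s'.2).1
    fun h' => hne (Subtype.ext h')) (hf s.1 s.2)
    ((show f s.1 s.2 = f s'.1 s'.2 from h) ▸ hf s'.1 s'.2)

/-- The edges of `M` together with the edges opposite to the distinguished vertices of the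
triangles in `S`. -/
def frame (M S : Finset (Finset (Fin n))) (x : Finset (Fin n) → Fin n) :
    Finset (Finset (Fin n)) :=
  M ∪ S.image fun s => s.erase (x s)

theorem mem_frame {f : Finset (Fin n)} :
    f ∈ frame M S x ↔ f ∈ M ∨ ∃ s ∈ S, s.erase (x s) = f := by
  simp [frame]

theorem biUnion_frame :
    (frame M S x).biUnion id = M.biUnion id ∪ S.biUnion fun s => s.erase (x s) := by
  rw [frame, union_biUnion, image_biUnion]
  rfl

theorem biUnion_frame_mono {S' : Finset (Finset (Fin n))} (h : S' ⊆ S) :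
    (frame M S' x).biUnion id ⊆ (frame M S x).biUnion id :=
  biUnion_subset_biUnion_of_subset_left _ (union_subset_union_right (image_subset_image h))

theorem IsTilingTriple.card_of_mem_frame (h : IsTilingTriple H T M I) (hS : S ⊆ T)
    (hx : ∀ s ∈ S, x s ∈ s) {f : Finset (Fin n)} (hf : f ∈ frame M S x) : #f = 2 := by
  obtain hf | ⟨s, hs, rfl⟩ := mem_frame.1 hf
  · exact (h.2.1 f hf).2
  · rw [card_erase_of_mem (hx s hs), (h.1 s (hS hs)).2]

theorem IsTilingTriple.pairwise_frame (h : IsTilingTriple H T M I) (hS : S ⊆ T) :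
    (frame M S x : Set (Finset (Fin n))).Pairwise fun s₁ s₂ => Disjoint s₁ s₂ := by
  intro f hf f' hf' hne
  obtain hf | ⟨s, hs, rfl⟩ := mem_frame.1 (mem_coe.1 hf)
  · obtain hf' | ⟨s', hs', rfl⟩ := mem_frame.1 (mem_coe.1 hf')
    · exact h.2.2.2.1 (mem_coe.2 (mem_union_right _ hf)) (mem_coe.2 (mem_union_right _ hf')) hne
    · exact (disjoint_of_subset_left (erase_subset _ _) (h.disjoint_of_mem (hS hs') hf)).symm
  · obtain hf' | ⟨s', hs', rfl⟩ := mem_frame.1 (mem_coe.1 hf')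
    · exact disjoint_of_subset_left (erase_subset _ _) (h.disjoint_of_mem (hS hs) hf')
    · refine disjoint_of_subset_left (erase_subset _ _)
        (disjoint_of_subset_right (erase_subset _ _) (h.2.2.2.1
          (mem_coe.2 (mem_union_left _ (hS hs))) (mem_coe.2 (mem_union_left _ (hS hs'))) ?_))
      rintro rfl
      exact hne rfl

theorem IsTilingTriple.card_frame (h : IsTilingTriple H T M I) (hS : S ⊆ T)
    (hx : ∀ s ∈ S, x s ∈ s) : #(frame M S x) = #M + #S := by
  have hne : ∀ s ∈ S, (s.erase (x s)).Nonempty := fun s hs => card_pos.1 (by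
    rw [card_erase_of_mem (hx s hs), (h.1 s (hS hs)).2]; norm_num)
  rw [frame, card_union_of_disjoint, card_image_of_injOn]
  · intro s hs s' hs' heq
    by_contra hss
    obtain ⟨v, hv⟩ := hne s hs
    have hd : Disjoint s s' := h.2.2.2.1 (mem_coe.2 (mem_union_left _ (hS hs)))
      (mem_coe.2 (mem_union_left _ (hS hs'))) hss
    refine disjoint_left.1 hd (mem_of_mem_erase hv) ?_
    rw [show s.erase (x s) = s'.erase (x s') from heq] at hv
    exact mem_of_mem_erase hv
  · rw [disjoint_right]
    intro f hf hfM
    obtain ⟨s, hs, rfl⟩ := mem_image.1 hf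
    obtain ⟨v, hv⟩ := hne s hs
    exact disjoint_left.1 (h.disjoint_of_mem (hS hs) hfM) (mem_of_mem_erase hv) hv

theorem IsTilingTriple.card_biUnion_frame (h : IsTilingTriple H T M I) (hS : S ⊆ T)
    (hx : ∀ s ∈ S, x s ∈ s) : #((frame M S x).biUnion id) = 2 * (#M + #S) := by
  rw [card_biUnion (t := id) (fun f hf f' hf' hne => h.pairwise_frame hS hf hf' hne),
    sum_const_nat (m := 2) (f := fun f => #(id f)) fun f hf => h.card_of_mem_frame hS hx hf,
    h.card_frame hS hx, mul_comm]

theorem card_filter_disjoint_ge {F G : Finset (Finset (Fin n))} (hG : G ⊆ F)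
    (τ : Finset (Fin n)) : #G ≤ #{e ∈ G | Disjoint e τ} + #{e ∈ F | ¬ Disjoint e τ} := by
  rw [← card_filter_add_card_filter_not (s := G) (fun e => Disjoint e τ)]
  exact Nat.add_le_add_left (card_le_card (filter_subset_filter _ hG)) _

/-- If every distinguished vertex is seen by at least six edges of `M`, then the vertices of the
frame span no triangle. -/
theorem IsMaxTilingTriple.not_isNClique_three_of_six_le (h : IsMaxTilingTriple H T M I)
    (hS : S ⊆ T) (hx : ∀ s ∈ S, x s ∈ s) (hsee : ∀ s ∈ S, 6 ≤ #(seeing H M s (x s)))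
    {τ : Finset (Fin n)} (hτ : τ ⊆ (frame M S x).biUnion id) : ¬ H.IsNClique 3 τ := by
  intro hcl
  have hTd : (T : Set (Finset (Fin n))).Pairwise fun s₁ s₂ => Disjoint s₁ s₂ :=
    h.1.2.2.2.1.mono (coe_subset.2 subset_union_left)
  have hMd : (M : Set (Finset (Fin n))).Pairwise fun s₁ s₂ => Disjoint s₁ s₂ :=
    h.1.2.2.2.1.mono (coe_subset.2 subset_union_right)
  have hc := hcl.2
  refine h.not_isNClique_three (x := x) (S := {s ∈ S | ¬ Disjoint s τ})
    ((filter_subset _ _).trans hS) ?_ (fun s hs => hx s (mem_filter.1 hs).1) ?_ hcl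
  · intro v hv
    have := hτ hv
    rw [biUnion_frame, mem_union] at this
    refine mem_union.2 (this.imp id fun h' => ?_)
    obtain ⟨s, hs, hvs⟩ := mem_biUnion.1 h'
    exact mem_biUnion.2 ⟨s, mem_filter.2 ⟨hs, not_disjoint_iff.2
      ⟨v, mem_of_mem_erase hvs, hv⟩⟩, hvs⟩
  · intro s hs
    have h1 := card_filter_not_disjoint_le (hTd.mono (coe_subset.2 hS)) τ
    have h2 := card_filter_not_disjoint_le hMd τ
    have h3 := card_filter_disjoint_ge (G := seeing H M s (x s))
      (fun e he => (mem_seeing.1 he).1) τ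
    have h4 := hsee s (mem_filter.1 hs).1
    omega

theorem IsMaxTilingTriple.degIn_le_one (h : IsMaxTilingTriple H T M I)
    (hS : S ⊆ T) (hx : ∀ s ∈ S, x s ∈ s) (hsee : ∀ s ∈ S, 2 ≤ #(seeing H M s (x s)))
    {f : Finset (Fin n)} (hf : f ∈ frame M S x) {w : Fin n}
    (hw : w ∈ (frame M S x).biUnion id) : degIn H f w ≤ 1 := by
  classical
  have hf2 := h.1.card_of_mem_frame hS hx hf
  by_cases hwf : w ∈ f
  · have := degIn_add_one_le_card H hwf
    omega
  by_contra! hcon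
  have hMd : (M : Set (Finset (Fin n))).Pairwise fun s₁ s₂ => Disjoint s₁ s₂ :=
    h.1.2.2.2.1.mono (coe_subset.2 subset_union_right)
  have hadj : ∀ u ∈ f, H.Adj w u := by
    have : f.filter (H.Adj w) = f := eq_of_subset_of_card_le (filter_subset _ _) (by
      rw [hf2]
      exact (Nat.succ_le_of_lt hcon).trans (le_of_eq (by unfold degIn; congr)))
    exact fun u hu => (mem_filter.1 (this ▸ hu)).2
  have hfcl : H.IsNClique 2 f := by
    obtain hf | ⟨s, hs, rfl⟩ := mem_frame.1 hf
    · exact h.1.2.1 f hf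
    · exact ⟨(h.1.1 s (hS hs)).1.subset (coe_subset.2 (erase_subset _ _)), hf2⟩
  have hcl : H.IsNClique 3 (insert w f) := hfcl.insert hadj
  have hone : ∀ g ∈ M, w ∈ g → #{e ∈ M | ¬ Disjoint e {w}} ≤ 1 := fun g _ _ => by
    simpa using card_filter_not_disjoint_le hMd {w}
  obtain ⟨g, hg, hwg⟩ := mem_biUnion.1 hw
  rw [id] at hwg
  obtain hg | ⟨s', hs', rfl⟩ := mem_frame.1 hg <;> obtain hf | ⟨s, hs, rfl⟩ := mem_frame.1 hf
  · refine h.not_isNClique_three (x := x) (S := ∅) (empty_subset _) ?_ (by simp) (by simp) hcl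
    rw [biUnion_empty, union_empty]
    exact insert_subset (mem_biUnion.2 ⟨g, hg, hwg⟩) (subset_biUnion_of_mem id hf)
  · refine h.not_isNClique_three (x := x) (S := {s}) (singleton_subset_iff.2 (hS hs)) ?_
      (by simpa using hx s hs) ?_ hcl
    · rw [singleton_biUnion]
      exact insert_subset (mem_union_left _ (mem_biUnion.2 ⟨g, hg, hwg⟩)) subset_union_right
    · simp only [mem_singleton, forall_eq, card_singleton]
      have h3 := card_filter_disjoint_ge (G := seeing H M s (x s))
        (fun e he => (mem_seeing.1 he).1) {w}
      have h4 := hsee s hs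
      have h5 := hone g hg hwg
      have h6 : {e ∈ seeing H M s (x s) | Disjoint e {w}} ⊆
          {e ∈ seeing H M s (x s) | Disjoint e (insert w (s.erase (x s)))} := by
        intro e he
        rw [mem_filter] at he ⊢
        rw [disjoint_insert_right]
        exact ⟨he.1, disjoint_singleton_right.1 he.2, (disjoint_of_subset_left (erase_subset _ _)
          (h.1.disjoint_of_mem (hS hs) (mem_seeing.1 he.1).1)).symm⟩
      have h7 := card_le_card h6
      omega
  · refine h.not_isNClique_three (x := x) (S := {s'}) (singleton_subset_iff.2 (hS hs')) ?_
      (by simpa using hx s' hs') ?_ hcl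
    · rw [singleton_biUnion]
      exact insert_subset (mem_union_right _ hwg)
        ((subset_biUnion_of_mem id hf).trans subset_union_left)
    · simp only [mem_singleton, forall_eq, card_singleton]
      have h4 := hsee s' hs'
      have h6 : (seeing H M s' (x s')).erase f ⊆
          {e ∈ seeing H M s' (x s') | Disjoint e (insert w f)} := by
        intro e he
        rw [mem_erase] at he
        have heM := (mem_seeing.1 he.2).1
        rw [mem_filter, disjoint_insert_right]
        exact ⟨he.2, disjoint_left.1 (h.1.disjoint_of_mem (hS hs') heM) (mem_of_mem_erase hwg),
          hMd heM hf he.1⟩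
      have h7 := card_le_card h6
      have h8 := pred_card_le_card_erase (s := seeing H M s' (x s')) (a := f)
      omega
  · have hss : s ≠ s' := by
      rintro rfl
      exact hwf hwg
    refine h.not_isNClique_three (x := x) (S := {s, s'})
      (insert_subset (hS hs) (singleton_subset_iff.2 (hS hs'))) ?_
      (by simpa using ⟨hx s hs, hx s' hs'⟩) ?_ hcl
    · refine subset_trans ?_ subset_union_right
      rw [biUnion_insert, singleton_biUnion]
      exact insert_subset (mem_union_right _ hwg) subset_union_left
    · rw [card_pair hss]
      intro r hr
      have hrS : r ∈ S := by
        rw [mem_insert, mem_singleton] at hr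
        rcases hr with rfl | rfl <;> assumption
      refine (hsee r hrS).trans (card_le_card fun e he => ?_)
      have heM := (mem_seeing.1 he).1
      rw [mem_filter, disjoint_insert_right]
      exact ⟨he, disjoint_left.1 (h.1.disjoint_of_mem (hS hs') heM) (mem_of_mem_erase hwg),
        (disjoint_of_subset_left (erase_subset _ _) (h.1.disjoint_of_mem (hS hs) heM)).symm⟩

theorem IsMaxTilingTriple.degIn_frame_le (h : IsMaxTilingTriple H T M I)
    (hS : S ⊆ T) (hx : ∀ s ∈ S, x s ∈ s) (hsee : ∀ s ∈ S, 2 ≤ #(seeing H M s (x s)))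
    {w : Fin n} (hw : w ∈ (frame M S x).biUnion id) :
    degIn H ((frame M S x).biUnion id) w ≤ #M + #S := by
  refine (degIn_biUnion_le H _ _ w).trans ?_
  rw [← h.1.card_frame hS hx, card_eq_sum_ones]
  exact sum_le_sum fun f hf => h.degIn_le_one hS hx hsee hf hw

end Frame

section Stability

theorem card_add_degIn_le {V : Type*} (H : SimpleGraph V) {X Y : Finset V} (h : X ⊆ Y) (v : V) :
    #X + degIn H Y v ≤ #Y + degIn H X v := by
  classical
  have h1 := degIn_union_le H X (Y \ X) v
  rw [union_sdiff_of_subset h] at h1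
  have h2 := degIn_le_card H (Y \ X) v
  have h3 := card_sdiff_add_card_eq_card h
  omega

/-- A triangle-free vertex set spanning almost `K ^ 2` edges splits into two parts with few
non-adjacent pairs between them. -/
theorem exists_bipartition_of_triangleFree {V : Type*} [DecidableEq V] (H : SimpleGraph V)
    (W : Finset V) (hW : ∀ τ ⊆ W, ¬ H.IsNClique 3 τ) {K Δ : ℕ} (hK : #W ≤ 2 * K)
    (hadj : 2 * K ^ 2 ≤ adjPairs H W W + Δ) :
    ∃ B C, Disjoint B C ∧ B ∪ C = W ∧ #B * #C ≤ adjPairs H B C + Δ ∧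
      2 * K ^ 2 ≤ 2 * (#B * #C) + Δ := by
  classical
  obtain rfl | hne := W.eq_empty_or_nonempty
  · refine ⟨∅, ∅, by simp, by simp, by simp, ?_⟩
    simpa [adjPairs] using hadj
  obtain ⟨v, hv, hmax⟩ := exists_max_image W (degIn H W) hne
  have hBW : W.filter (H.Adj v) ⊆ W := filter_subset _ _
  have hcB : #(W.filter (H.Adj v)) = degIn H W v := by
    unfold degIn
    congr
  have hind : adjPairs H (W.filter (H.Adj v)) (W.filter (H.Adj v)) = 0 := by
    refine sum_eq_zero fun a ha => ?_
    rw [degIn, card_eq_zero, filter_eq_empty_iff]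
    intro b hb hab
    rw [mem_filter] at ha hb
    refine hW {v, a, b} ?_ (SimpleGraph.is3Clique_triple_iff.2 ⟨ha.2, hb.2, hab⟩)
    simp [insert_subset_iff, hv, ha.1, hb.1]
  have hu : W.filter (H.Adj v) ∪ W \ W.filter (H.Adj v) = W := union_sdiff_of_subset hBW
  have hd : Disjoint (W.filter (H.Adj v)) (W \ W.filter (H.Adj v)) := disjoint_sdiff
  have hC : ∀ c ∈ W \ W.filter (H.Adj v), degIn H W c ≤ #(W.filter (H.Adj v)) := fun c hc => by
    rw [hcB]
    exact hmax c (mem_sdiff.1 hc).1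
  generalize W.filter (H.Adj v) = B at *
  generalize W \ B = C at *
  have h1 := adjPairs_le_card_mul H C W hC
  have h2 := adjPairs_union_self H hd
  have h3 := adjPairs_union_right H hd C
  rw [hu] at h2 h3
  rw [adjPairs_comm H C B] at h3
  have h4 := adjPairs_le_mul H B C
  rw [mul_comm] at h1
  have h5 := card_union_of_disjoint hd
  rw [hu] at h5
  have h6 : #B * #C ≤ K ^ 2 := by
    have : #B + #C ≤ 2 * K := by omega
    nlinarith [sq_nonneg ((#B : ℤ) - #C), Nat.mul_le_mul this this, two_mul_le_add_sq #B #C]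
  exact ⟨B, C, hd, hu, by omega, by omega⟩

/-- A triangle-free vertex set spanning almost `K ^ 2` edges contains two balanced parts that
cover almost all of it and are almost completely joined. -/
theorem exists_robust_bipartition {V : Type*} [DecidableEq V] (H : SimpleGraph V)
    (W : Finset V) (hfree : ∀ τ ⊆ W, ¬ H.IsNClique 3 τ) {K q : ℕ} (hq : 0 < q) (hK : #W ≤ 2 * K)
    (hadj : 2 * K ^ 2 ≤ adjPairs H W W + q ^ 2) :
    ∃ B ⊆ W, ∃ C ⊆ W, Disjoint B C ∧ #B + #C ≤ #W ∧ #W ≤ #B + #C + 2 * q ∧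
      #B ≤ #C + 3 * q ∧ #C ≤ #B + 3 * q ∧
      (∀ v ∈ B, #C ≤ degIn H C v + q) ∧ ∀ v ∈ C, #B ≤ degIn H B v + q := by
  classical
  obtain ⟨B₀, C₀, hBC, hBCu, hBC1, hBC2⟩ := exists_bipartition_of_triangleFree H _ hfree
    hK hadj
  have hcard := card_union_of_disjoint hBC
  rw [hBCu] at hcard
  have hdist : #B₀ ≤ #C₀ + 2 * q ∧ #C₀ ≤ #B₀ + 2 * q := by
    have h1 : #B₀ + #C₀ ≤ 2 * K := by omega
    have h2 : (#B₀ + #C₀) * (#B₀ + #C₀) ≤ 2 * K * (2 * K) := Nat.mul_le_mul h1 h1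
    have h3 : ((#B₀ : ℤ) - #C₀) ^ 2 ≤ (2 * q) ^ 2 := by
      zify at h2 hBC2
      nlinarith
    have h4 := abs_le.1 (abs_le_of_sq_le_sq h3 (by omega))
    omega
  have hB1 := card_filter_mul_le H B₀ C₀ q
  have hC1 := card_filter_mul_le H C₀ B₀ q
  rw [adjPairs_comm H C₀ B₀, mul_comm #C₀ #B₀] at hC1
  have hB2 := card_filter_add_card_filter_not (s := B₀) fun v => degIn H C₀ v + q < #C₀
  have hC2 := card_filter_add_card_filter_not (s := C₀) fun v => degIn H B₀ v + q < #B₀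
  have hB3 : #{v ∈ B₀ | degIn H C₀ v + q < #C₀} ≤ q :=
    Nat.le_of_mul_le_mul_right (by nlinarith) hq
  have hC3 : #{v ∈ C₀ | degIn H B₀ v + q < #B₀} ≤ q :=
    Nat.le_of_mul_le_mul_right (by nlinarith) hq
  have hBs := filter_subset (fun v => ¬ degIn H C₀ v + q < #C₀) B₀
  have hCs := filter_subset (fun v => ¬ degIn H B₀ v + q < #B₀) C₀
  have hBg : ∀ v ∈ {v ∈ B₀ | ¬ degIn H C₀ v + q < #C₀}, #C₀ ≤ degIn H C₀ v + q :=
    fun v hv => not_lt.1 (mem_filter.1 hv).2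
  have hCg : ∀ v ∈ {v ∈ C₀ | ¬ degIn H B₀ v + q < #B₀}, #B₀ ≤ degIn H B₀ v + q :=
    fun v hv => not_lt.1 (mem_filter.1 hv).2
  refine ⟨_, hBs.trans (hBCu ▸ subset_union_left), _, hCs.trans (hBCu ▸ subset_union_right),
    disjoint_of_subset_left hBs (disjoint_of_subset_right hCs hBC), by omega, by omega, by omega,
    by omega, fun v hv => ?_, fun v hv => ?_⟩
  · have h1 := card_add_degIn_le H hCs v
    have h2 := hBg v hv
    omega
  · have h1 := card_add_degIn_le H hBs v
    have h2 := hCg v hv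
    omega

theorem deficiency_le {n : ℕ} {H : SimpleGraph (Fin n)} {A W : Finset (Fin n)}
    (hd : Disjoint A W) {t K r : ℕ} (hW : #W = 2 * K) (hr : #A + 2 * K + r = n)
    (ht : #A ≤ t + 1) (htn : t + 1 ≤ n)
    (hP : 2 * ((t : ℤ) * (n - 1) + t * (n - t)) + (n - t) ^ 2 + 7 ≤
      2 * (adjPairs H univ univ : ℤ)) :
    2 * (#A * (2 * K)) + 2 * K ^ 2 ≤
      2 * adjPairs H A W + adjPairs H W W + (2 * r + 1) * n := by
  have hdR : Disjoint (A ∪ W) (univ \ (A ∪ W)) := disjoint_sdiff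
  have hu : (A ∪ W) ∪ univ \ (A ∪ W) = univ := union_sdiff_of_subset (subset_univ _)
  have hc := congrArg card hu
  rw [card_univ, Fintype.card_fin, card_union_of_disjoint hdR, card_union_of_disjoint hd] at hc
  have h1 := adjPairs_union_self H hdR
  have h2 := adjPairs_union_right H hdR (univ \ (A ∪ W))
  rw [hu] at h1 h2
  have h3 := adjPairs_le_mul H (univ \ (A ∪ W)) univ
  have h4 := adjPairs_comm H (A ∪ W) (univ \ (A ∪ W))
  have h5 := adjPairs_union_self H hd
  have h6 := adjPairs_le_mul H A A
  have hr' : #(univ \ (A ∪ W)) = r := by omega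
  rw [hr', card_univ, Fintype.card_fin] at h3
  have h7 : adjPairs H univ univ ≤
      2 * (r * n) + (#A * #A + 2 * adjPairs H A W + adjPairs H W W) := by omega
  generalize #A = a at *
  subst hr
  zify at h7 ⊢
  have h8 : (0 : ℤ) ≤ (t + 1 - a) * ((2 * K + r) + (a + 2 * K + r - t - 1)) :=
    mul_nonneg (by omega) (by omega)
  push_cast at *
  nlinarith

theorem six_le_card_seeing {n : ℕ} {H : SimpleGraph (Fin n)} {M : Finset (Finset (Fin n))}
    {s W : Finset (Fin n)} {v : Fin n} {q : ℕ} (hv : v ∈ s) (hMW : M.biUnion id ⊆ W)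
    (hMd : (M : Set (Finset (Fin n))).Pairwise fun s₁ s₂ => Disjoint s₁ s₂)
    (hq : #W ≤ degIn H W v + q) : #M ≤ #(seeing H M s v) + q := by
  classical
  have h1 := card_add_degIn_le H hMW v
  have h2 : M ⊆ seeing H M s v ∪
      {e ∈ M | ¬ Disjoint e {w ∈ M.biUnion id | ¬ H.Adj v w}} := by
    intro e he
    rw [mem_union, mem_seeing, mem_filter]
    by_cases hs : seesAt H e s v
    · exact Or.inl ⟨he, hs⟩
    · refine Or.inr ⟨he, ?_⟩
      simp only [seesAt, not_and, not_forall] at hs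
      obtain ⟨u, hu, huv⟩ := hs hv
      exact not_disjoint_iff.2 ⟨u, hu, mem_filter.2 ⟨mem_biUnion.2 ⟨e, he, hu⟩,
        fun h => huv h.symm⟩⟩
  have h3 := (card_le_card h2).trans (card_union_le _ _)
  have h4 := card_filter_not_disjoint_le hMd {w ∈ M.biUnion id | ¬ H.Adj v w}
  have h5 : degIn H (M.biUnion id) v + #{w ∈ M.biUnion id | ¬ H.Adj v w} = #(M.biUnion id) := by
    rw [← card_filter_add_card_filter_not (s := M.biUnion id) (H.Adj v)]
    unfold degIn
    congr
  omega

end Stability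

section Structure

/-- The critical vertices of `S` form a set disjoint from the frame of `S`. -/
theorem IsTilingTriple.disjoint_image_frame {n : ℕ} {H : SimpleGraph (Fin n)}
    {T M : Finset (Finset (Fin n))} {I : Finset (Fin n)} (h : IsTilingTriple H T M I)
    {S : Finset (Finset (Fin n))} {x : Finset (Fin n) → Fin n} (hS : S ⊆ T)
    (hx : ∀ s ∈ S, x s ∈ s) : Disjoint (S.image x) ((frame M S x).biUnion id) := by
  rw [disjoint_left, biUnion_frame]
  intro v hv hv'
  obtain ⟨s, hs, rfl⟩ := mem_image.1 hv
  obtain hv' | hv' := mem_union.1 hv'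
  · obtain ⟨e, he, hse⟩ := mem_biUnion.1 hv'
    exact disjoint_left.1 (h.disjoint_of_mem (hS hs) he) (hx s hs) hse
  · obtain ⟨s', hs', hss'⟩ := mem_biUnion.1 hv'
    rw [mem_erase] at hss'
    obtain rfl | hne := eq_or_ne s s'
    · exact hss'.1 rfl
    · exact disjoint_left.1 (h.2.2.2.1 (mem_coe.2 (mem_union_left _ (hS hs)))
        (mem_coe.2 (mem_union_left _ (hS hs'))) hne) (hx s hs) hss'.2

theorem IsTilingTriple.injOn_of_mem {n : ℕ} {H : SimpleGraph (Fin n)}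
    {T M : Finset (Finset (Fin n))} {I : Finset (Fin n)} (h : IsTilingTriple H T M I)
    {S : Finset (Finset (Fin n))} {x : Finset (Fin n) → Fin n} (hS : S ⊆ T)
    (hx : ∀ s ∈ S, x s ∈ s) : Set.InjOn x S := by
  intro s hs s' hs' heq
  by_contra hne
  exact disjoint_left.1 (h.2.2.2.1 (mem_coe.2 (mem_union_left _ (hS hs)))
    (mem_coe.2 (mem_union_left _ (hS hs'))) hne) (hx s hs) (heq ▸ hx s' hs')

/-- All but few triangles of `S` have a critical vertex adjacent to almost the whole frame, and
the frame of those triangles is triangle-free and dense. -/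
theorem IsMaxTilingTriple.exists_dense_frame {n : ℕ} {H : SimpleGraph (Fin n)}
    {T M : Finset (Finset (Fin n))} {I : Finset (Fin n)} (h : IsMaxTilingTriple H T M I)
    {S : Finset (Finset (Fin n))} {x : Finset (Fin n) → Fin n} (hS : S ⊆ T)
    (hx : ∀ s ∈ S, x s ∈ s) (hsee : ∀ s ∈ S, 2 ≤ #(seeing H M s (x s))) {t r q : ℕ}
    (hP : 2 * ((t : ℤ) * (n - 1) + t * (n - t)) + (n - t) ^ 2 + 7 ≤
      2 * (adjPairs H univ univ : ℤ))
    (htn : t + 1 ≤ n) (hSt : #S ≤ t + 1) (hr : 3 * #S + 2 * #M + r = n) (hM : q + 6 ≤ #M) :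
    ∃ S' ⊆ S, ∃ b, #S' + b = #S ∧ b * q ≤ (2 * r + 1) * n ∧
      (∀ s ∈ S', 2 * (#M + #S) ≤ degIn H ((frame M S x).biUnion id) (x s) + q) ∧
      (∀ τ ⊆ (frame M S' x).biUnion id, ¬ H.IsNClique 3 τ) ∧
      2 * (#M + #S) ^ 2 ≤
        adjPairs H ((frame M S' x).biUnion id) ((frame M S' x).biUnion id) +
          ((2 * r + 1) * n + 4 * (b * (#M + #S))) := by
  have hMd : (M : Set (Finset (Fin n))).Pairwise fun s₁ s₂ => Disjoint s₁ s₂ :=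
    h.1.2.2.2.1.mono (coe_subset.2 subset_union_right)
  have hxinj := h.1.injOn_of_mem hS hx
  have hWc := h.1.card_biUnion_frame hS hx
  have hdef := deficiency_le (h.1.disjoint_image_frame hS hx) (K := #M + #S) (r := r) hWc
    (by rw [card_image_of_injOn hxinj]; omega) (by rwa [card_image_of_injOn hxinj]) htn hP
  have hbad := card_filter_mul_le H (S.image x) ((frame M S x).biUnion id) q
  have hWW := adjPairs_le_card_mul H ((frame M S x).biUnion id) ((frame M S x).biUnion id)
    fun w hw => h.degIn_frame_le hS hx hsee hw
  rw [filter_image, card_image_of_injOn (hxinj.mono (coe_subset.2 (filter_subset _ _))),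
    card_image_of_injOn hxinj, hWc] at hbad
  rw [card_image_of_injOn hxinj] at hdef
  rw [hWc] at hWW
  obtain ⟨S', hS'def⟩ : ∃ S', S' = {s ∈ S | ¬ degIn H ((frame M S x).biUnion id) (x s) + q <
    2 * (#M + #S)} := ⟨_, rfl⟩
  have hS' : S' ⊆ S := hS'def ▸ filter_subset _ _
  have hsplit := card_filter_add_card_filter_not (s := S)
    fun s => degIn H ((frame M S x).biUnion id) (x s) + q < 2 * (#M + #S)
  rw [← hS'def] at hsplit
  have hgood : ∀ s ∈ S', 2 * (#M + #S) ≤ degIn H ((frame M S x).biUnion id) (x s) + q := by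
    intro s hs
    rw [hS'def, mem_filter] at hs
    exact not_lt.1 hs.2
  generalize #{s ∈ S | degIn H ((frame M S x).biUnion id) (x s) + q < 2 * (#M + #S)} = b at *
  have hfree : ∀ τ ⊆ (frame M S' x).biUnion id, ¬ H.IsNClique 3 τ := by
    intro τ hτ
    refine h.not_isNClique_three_of_six_le (hS'.trans hS) (fun s hs => hx s (hS' hs)) ?_ hτ
    intro s hs
    have := six_le_card_seeing (H := H) (hx s (hS' hs))
      (biUnion_frame (M := M) (S := S) (x := x) ▸ subset_union_left) hMd (hWc ▸ hgood s hs)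
    omega
  have hW'c := h.1.card_biUnion_frame (hS'.trans hS) fun s hs => hx s (hS' hs)
  have hW'W := biUnion_frame_mono (M := M) (x := x) hS'
  have hdiff := card_sdiff_add_card_eq_card hW'W
  rw [hWc, hW'c] at hdiff
  have hDW := adjPairs_le_card_mul H ((frame M S x).biUnion id \ (frame M S' x).biUnion id)
    ((frame M S x).biUnion id)
    fun w hw => h.degIn_frame_le hS hx hsee (mem_sdiff.1 hw).1
  have hu := union_sdiff_of_subset hW'W
  have hdd : Disjoint ((frame M S' x).biUnion id)
    ((frame M S x).biUnion id \ (frame M S' x).biUnion id) := disjoint_sdiff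
  have hs1 := adjPairs_union_self H hdd
  have hs2 := adjPairs_union_right H hdd
    ((frame M S x).biUnion id \ (frame M S' x).biUnion id)
  rw [hu] at hs1 hs2
  rw [adjPairs_comm H _ ((frame M S' x).biUnion id)] at hs2
  have hDc : #((frame M S x).biUnion id \ (frame M S' x).biUnion id) = 2 * b := by omega
  rw [hDc] at hDW
  refine ⟨S', hS', b, by omega, ?_, hgood, hfree, ?_⟩
  · have : 2 * (#M + #S) * (#M + #S) = 2 * (#M + #S) ^ 2 := by ring
    clear hs1 hs2 hDW hgood hfree hdiff
    generalize 2 * (#M + #S) * (#M + #S) = y at *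
    generalize #S * (2 * (#M + #S)) = z at *
    generalize (2 * r + 1) * n = y' at *
    omega
  · have h1 : 2 * b * (#M + #S) = 2 * (b * (#M + #S)) := mul_assoc _ _ _
    clear hgood hfree hdiff
    generalize #S * (2 * (#M + #S)) = z at *
    generalize (2 * r + 1) * n = y' at *
    generalize (#M + #S) ^ 2 = y at *
    rw [h1] at hDW
    generalize b * (#M + #S) = y₂ at *
    omega

theorem IsMaxTilingTriple.exists_isRobustTriple {n : ℕ} {H : SimpleGraph (Fin n)}
    {T M : Finset (Finset (Fin n))} {I : Finset (Fin n)} (h : IsMaxTilingTriple H T M I)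
    {S : Finset (Finset (Fin n))} {x : Finset (Fin n) → Fin n} (hS : S ⊆ T)
    (hx : ∀ s ∈ S, x s ∈ s) (hsee : ∀ s ∈ S, 2 ≤ #(seeing H M s (x s))) {t r q : ℕ}
    (hP : 2 * ((t : ℤ) * (n - 1) + t * (n - t)) + (n - t) ^ 2 + 7 ≤
      2 * (adjPairs H univ univ : ℤ))
    (ht : 9 * t ≤ 2 * n + 3) (hSt : #S ≤ t + 1) (htS : t ≤ #S + 1)
    (hr : 3 * #S + 2 * #M + r = n) (hq : 0 < q) (hqn : 50000 * q ≤ n) (hnq : n ≤ 10 ^ 6 * q)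
    (hrq : r ≤ q) (hsmall : 10 ^ 8 * ((2 * r + 1) * n) ≤ q ^ 2) (hM : q + 6 ≤ #M) :
    ∃ A B C, IsRobustTriple H t (10 * q) A B C := by
  obtain ⟨S', hS', b, hb', hbq, hgood, hfree, hWdef⟩ :=
    h.exists_dense_frame hS hx hsee hP (by omega) hSt hr hM
  have hxinj := h.1.injOn_of_mem hS hx
  have hAW' := h.1.disjoint_image_frame hS hx
  have hWc := h.1.card_biUnion_frame hS hx
  have hW'c := h.1.card_biUnion_frame (hS'.trans hS) fun s hs => hx s (hS' hs)
  have hW'W := biUnion_frame_mono (M := M) (x := x) hS'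
  obtain ⟨K, hK⟩ : ∃ K, K = #M + #S := ⟨_, rfl⟩
  rw [← hK] at hgood hWdef hWc
  have hbn : b * n ≤ 10 ^ 6 * ((2 * r + 1) * n) := by
    calc b * n ≤ b * (10 ^ 6 * q) := Nat.mul_le_mul_left _ hnq
      _ = 10 ^ 6 * (b * q) := by ring
      _ ≤ _ := Nat.mul_le_mul_left _ hbq
  have hbK : b * K ≤ b * n := Nat.mul_le_mul_left _ (by omega)
  have hb : b ≤ q := by
    have : b * q ≤ q * q := by nlinarith
    exact Nat.le_of_mul_le_mul_right this hq
  obtain ⟨B, hB, C, hC, hdBC, hBC1, hBC2, hBC3, hBC4, hBg, hCg⟩ :=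
    exists_robust_bipartition H _ hfree (K := K) hq (by omega) (by omega)
  rw [hW'c] at hBC1 hBC2
  have hBW := hB.trans hW'W
  have hCW := hC.trans hW'W
  have hdAB := disjoint_of_subset_right hBW (disjoint_of_subset_left (image_subset_image hS') hAW')
  have hdAC := disjoint_of_subset_right hCW (disjoint_of_subset_left (image_subset_image hS') hAW')
  have hcA : #(S'.image x) = #S' := card_image_of_injOn (hxinj.mono (coe_subset.2 hS'))
  refine ⟨S'.image x, B, C, ?_⟩
  constructor
  · omega
  · omega
  · omega
  · omega
  · omega
  · exact hdAB
  · exact hdAC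
  · exact hdBC
  · omega
  · omega
  · omega
  · omega
  · rw [card_sdiff_of_subset (subset_univ _), card_univ, Fintype.card_fin,
      card_union_of_disjoint (disjoint_union_left.2 ⟨hdAC, hdBC⟩), card_union_of_disjoint hdAB]
    omega
  · intro v hv
    have := hBg v hv
    omega
  · intro v hv
    have := hCg v hv
    omega
  · intro a ha
    obtain ⟨s, hs, rfl⟩ := mem_image.1 ha
    have h1 := card_add_degIn_le H hBW (x s)
    have h2 := card_add_degIn_le H hCW (x s)
    have h3 := hgood s hs
    omega

end Structure

section Parameters

/-- The parameters of the stability hypotheses meet the requirements of the robust structure. -/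
theorem exists_parameters {n t s m : ℕ} (hn : 10 ^ 50 ≤ n) (ht : (t : ℝ) ≤ (2 * n - 6) / 9 + 1)
    (hs : t - 1 ≤ s) (hs' : s ≤ t + 1)
    (hm : ((n : ℝ) - 3 * (t + 1)) / 2 - Real.sqrt (2 * n) / 2 < m)
    (hm' : (m : ℝ) ≤ ((n : ℝ) - 3 * (t + 1)) / 2) :
    ∃ r q : ℕ, 9 * t ≤ 2 * n + 3 ∧ t ≤ s + 1 ∧ 3 * s + 2 * m + r = n ∧ 0 < q ∧
      50000 * q ≤ n ∧ n ≤ 10 ^ 6 * q ∧ r ≤ q ∧ 10 ^ 8 * ((2 * r + 1) * n) ≤ q ^ 2 ∧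
      q + 6 ≤ m := by
  have hnR : (10 : ℝ) ^ 50 ≤ n := by exact_mod_cast hn
  have hσ : Real.sqrt (2 * n) ^ 2 = 2 * n := Real.sq_sqrt (by positivity)
  have hσ' : (10 : ℝ) ^ 25 ≤ Real.sqrt (2 * n) := Real.le_sqrt_of_sq_le (by linarith)
  generalize Real.sqrt (2 * n) = σ at *
  have hσn : 10 ^ 24 * σ ≤ n := by nlinarith
  have ht' : 9 * t ≤ 2 * n + 3 := by
    have : (9 : ℝ) * t ≤ 2 * n + 3 := by linarith
    exact_mod_cast this
  have hsR : (t : ℝ) ≤ s + 1 := by exact_mod_cast (by omega : t ≤ s + 1)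
  have hle : 3 * s + 2 * m ≤ n := by
    have h1 : (2 * m + 3 * (t + 1) : ℝ) ≤ n := by linarith
    have h2 : 2 * m + 3 * (t + 1) ≤ n := by exact_mod_cast h1
    omega
  obtain ⟨r, hr⟩ := Nat.exists_eq_add_of_le hle
  have hrR : (n : ℝ) = 3 * s + 2 * m + r := by exact_mod_cast hr
  have hrn : 10 ^ 20 * (2 * r + 1) ≤ n := by
    have : (10 : ℝ) ^ 20 * (2 * r + 1) ≤ n := by linarith
    exact_mod_cast this
  have hmn : n ≤ 10 * m := by
    have : (n : ℝ) ≤ 10 * m := by linarith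
    exact_mod_cast this
  have hq : n ≤ 10 ^ 6 * (n / 10 ^ 5) := by omega
  refine ⟨r, n / 10 ^ 5, ht', by omega, hr.symm, by omega, by omega, hq, by omega, ?_, by omega⟩
  have h1 : n * n ≤ 10 ^ 6 * (n / 10 ^ 5) * (10 ^ 6 * (n / 10 ^ 5)) := Nat.mul_le_mul hq hq
  have h2 : 10 ^ 20 * (2 * r + 1) * n ≤ n * n := Nat.mul_le_mul_right n hrn
  nlinarith

end Parameters

/-- Under the stability conclusions of Theorem 3.1, the subgraph of a
representative graph `H` induced by `V(T₁) ∪ V(M)` contains a complete 3-partite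
subgraph with part sizes `t₁−10`, `m+t₁−10`, `m+t₁−10`, where `t₁ = |T₁|`, `m = |M|`. -/
theorem statement7 (δ : ℝ) (hδ : 0 < δ) :
    ∃ N₀ : ℕ, ∀ n : ℕ, N₀ ≤ n → ∀ t : ℕ,
      δ * n ≤ t → (t : ℝ) ≤ (2 * n - 6) / 9 + 1 →
      ∀ χ : Sym2 (Fin n) → ℕ,
        IsSurjColoring n (exTriangles n (t + 1) + 2) χ →
        ¬ HasRainbowKTriangles (⊤ : SimpleGraph (Fin n)) χ (t + 2) →
        ∀ H : SimpleGraph (Fin n), IsRepGraph χ (exTriangles n (t + 1) + 2) H →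
        ∀ (T M : Finset (Finset (Fin n))) (I : Finset (Fin n)),
          IsMaxTilingTriple H T M I →
          ∀ T₁ T₂ T₃ T₄ : Finset (Finset (Fin n)),
            IsIdealPartition H T M I T₁ T₂ T₃ T₄ →
            (t - 1 ≤ T₁.card ∧ T₁.card ≤ t + 1) →
            (((n : ℝ) - 3 * (t + 1)) / 2 - Real.sqrt (2 * n) / 2 < M.card ∧
              (M.card : ℝ) ≤ ((n : ℝ) - 3 * (t + 1)) / 2) →
            (I.card : ℝ) < Real.sqrt (2 * n) →
            ∃ A B C : Finset (Fin n),
              ↑A ⊆ (↑(T₁.biUnion id ∪ M.biUnion id) : Set (Fin n)) ∧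
              ↑B ⊆ (↑(T₁.biUnion id ∪ M.biUnion id) : Set (Fin n)) ∧
              ↑C ⊆ (↑(T₁.biUnion id ∪ M.biUnion id) : Set (Fin n)) ∧
              Disjoint A B ∧ Disjoint A C ∧ Disjoint B C ∧
              A.card = T₁.card - 10 ∧
              B.card = M.card + T₁.card - 10 ∧
              C.card = M.card + T₁.card - 10 ∧
              (∀ a ∈ A, ∀ b ∈ B, H.Adj a b) ∧
              (∀ a ∈ A, ∀ c ∈ C, H.Adj a c) ∧
              (∀ b ∈ B, ∀ c ∈ C, H.Adj b c) := by
  refine ⟨10 ^ 50, fun n hn t _ ht χ hχ hno H hH T M I hmax T₁ T₂ T₃ T₄ hpart hT₁ hM _ =>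
    False.elim ?_⟩
  obtain ⟨r, q, ht', htS, hr, hq, hqn, hnq, hrq, hsmall, hMq⟩ :=
    exists_parameters hn ht hT₁.1 hT₁.2 hM.1 hM.2
  have hmem := hpart.2.2.2.2.2.2.2.1
  have hcrit : ∀ s : Finset (Fin n), ∃ w, s ∈ T₁ → w ∈ s ∧ 2 ≤ #(seeing H M s w) := by
    intro s
    by_cases hs : s ∈ T₁
    · obtain ⟨w, hw⟩ := hmax.exists_two_le_card_seeing ((hmem s).1 hs).1 ((hmem s).1 hs).2
      exact ⟨w, fun _ => hw⟩
    · exact ⟨⟨0, by omega⟩, fun h => absurd h hs⟩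
  choose x hx using hcrit
  have hP : 2 * ((t : ℤ) * (n - 1) + t * (n - t)) + (n - t) ^ 2 + 7 ≤
      2 * (adjPairs H univ univ : ℤ) := by
    have h1 := le_exTriangles (n := n) (t := t) (by omega)
    have h2 := two_mul_ncard_edgeSet H
    rw [hH.1] at h2
    omega
  obtain ⟨A, B, C, h⟩ := hmax.exists_isRobustTriple (fun s hs => ((hmem s).1 hs).1)
    (fun s hs => (hx s hs).1) (fun s hs => (hx s hs).2) hP ht' hT₁.2 htS hr hq hqn hnq hrq hsmall
    hMq
  exact h.contradiction hH.2 (fun u v huv => hH.exists_edge_color hχ huv) hno hP
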